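/- arXiv:1207.0715 — 3 statements merged into one kernel-verified Lean document; each statement's English description precedes it below -/
import Mathlib

section
/- Let n ≥ 3 and let E ⊂ ℝⁿ be a set of finite perimeter with |E| = |B_1|. Then there is a constant C = C(n) > 0, depending only on n, such that ∫_{B_1} ∫_{ℝⁿ} (χ_{B_1} − χ_E)(x) |x−y|^{2−n} dx dy ≤ C ∫_{ℝⁿ} (χ_{B_1} − χ_E)(x) |x|^{−1} dx. -/
open MeasureTheory Metric Set

noncomputable section

/-- The divergence of a vector field on `ℝⁿ`. -/
def vdiv {n : ℕ} (φ : EuclideanSpace ℝ (Fin n) → EuclideanSpace ℝ (Fin n))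
    (x : EuclideanSpace ℝ (Fin n)) : ℝ :=
  ∑ i, fderiv ℝ φ x (EuclideanSpace.single i 1) i

/-- The set of admissible values `∫_F div φ` in the variational definition of the
perimeter: `φ` ranges over compactly supported `C¹` vector fields with `‖φ‖ ≤ 1`. -/
def perimVals {n : ℕ} (F : Set (EuclideanSpace ℝ (Fin n))) : Set ℝ :=
  { r | ∃ φ : EuclideanSpace ℝ (Fin n) → EuclideanSpace ℝ (Fin n),
      ContDiff ℝ 1 φ ∧ HasCompactSupport φ ∧ (∀ x, ‖φ x‖ ≤ 1) ∧
      r = ∫ x in F, vdiv φ x }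

/-- The (distributional) perimeter `P(F)`. -/
def perimeter {n : ℕ} (F : Set (EuclideanSpace ℝ (Fin n))) : ℝ := sSup (perimVals F)

/-- `F` is a set of finite perimeter: it is measurable and the variational
definition of the perimeter is finite. -/
def HasFinitePerimeter {n : ℕ} (F : Set (EuclideanSpace ℝ (Fin n))) : Prop :=
  MeasurableSet F ∧ BddAbove (perimVals F)

/-- The Newtonian interaction energy `NL(F) = ∫∫ χ_F(x)χ_F(y)|x-y|^{2-n}`. -/
def NL {n : ℕ} (F : Set (EuclideanSpace ℝ (Fin n))) : ℝ :=
  ∫ x in F, ∫ y in F, ‖x - y‖ ^ (2 - (n : ℝ))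

/-- The function `f_E = χ_{B_1} - χ_E`. -/
def fE {n : ℕ} (E : Set (EuclideanSpace ℝ (Fin n))) (x : EuclideanSpace ℝ (Fin n)) : ℝ :=
  (ball (0 : EuclideanSpace ℝ (Fin n)) 1).indicator 1 x - E.indicator 1 x

/-- The Newtonian potential `v(y) = ∫ (χ_{B_1} - χ_E)(x) |x-y|^{2-n} dx`. -/
def newtPot {n : ℕ} (E : Set (EuclideanSpace ℝ (Fin n))) (y : EuclideanSpace ℝ (Fin n)) : ℝ :=
  ∫ x, fE E x * ‖x - y‖ ^ (2 - (n : ℝ))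

/-- The normalization constant `σ_{n,α}` of the Riesz potential. -/
def rieszConst (n : ℕ) (α : ℝ) : ℝ :=
  (Real.pi ^ ((n : ℝ) / 2) * 2 ^ α * Real.Gamma (α / 2) / Real.Gamma (((n : ℝ) - α) / 2))⁻¹

/-- The Riesz potential `I_α f(x) = σ_{n,α} ∫ f(ξ)|x-ξ|^{α-n} dξ`. -/
def rieszPot {n : ℕ} (α : ℝ) (f : EuclideanSpace ℝ (Fin n) → ℝ)
    (x : EuclideanSpace ℝ (Fin n)) : ℝ :=
  rieszConst n α * ∫ ξ, f ξ * ‖x - ξ‖ ^ (α - (n : ℝ))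

/-- The average of `g` over the sphere `∂B_r` with respect to the
`(n-1)`-dimensional Hausdorff measure. -/
def sphAvg {n : ℕ} (g : EuclideanSpace ℝ (Fin n) → ℝ) (r : ℝ) : ℝ :=
  (μH[(n : ℝ) - 1] (sphere (0 : EuclideanSpace ℝ (Fin n)) r)).toReal⁻¹ *
    ∫ y in sphere (0 : EuclideanSpace ℝ (Fin n)) r, g y ∂μH[(n : ℝ) - 1]

/-- The average of `g` over the ball `B_r` with respect to the Lebesgue measure. -/
def ballAvg {n : ℕ} (g : EuclideanSpace ℝ (Fin n) → ℝ) (r : ℝ) : ℝ :=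
  (volume (ball (0 : EuclideanSpace ℝ (Fin n)) r)).toReal⁻¹ *
    ∫ x in ball (0 : EuclideanSpace ℝ (Fin n)) r, g x

end

theorem s15_pointwise {a b s : ℝ} (ha : 0 < a) (hb : 0 < b) (hs : 0 ≤ s) :
    b ^ (-s) - a ^ (-s) ≤ s * |a - b| * b ^ (-s - 1) := by
  have hab : 0 < a / b := div_pos ha hb
  have h1 : 1 - s * (a / b - 1) ≤ (a / b) ^ (-s) := by
    rw [Real.rpow_def_of_pos hab]
    have h2 := Real.add_one_le_exp (Real.log (a / b) * -s)
    have h3 := Real.log_le_sub_one_of_pos hab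
    nlinarith
  have h2 : a ^ (-s) = (a / b) ^ (-s) * b ^ (-s) := by
    rw [← Real.mul_rpow hab.le hb.le, div_mul_cancel₀ _ hb.ne']
  have h3 : b ^ (-s - 1) = b ^ (-s) / b := by
    rw [Real.rpow_sub_one hb.ne']
  have hp : 0 < b ^ (-s) := Real.rpow_pos_of_pos hb _
  rw [h2, h3]
  have h4 : b ^ (-s) - (a / b) ^ (-s) * b ^ (-s) ≤ s * (a / b - 1) * b ^ (-s) := by
    nlinarith
  refine h4.trans ?_
  have h5 : s * (a / b - 1) * b ^ (-s) = s * (a - b) * (b ^ (-s) / b) := by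
    field_simp
  rw [h5]
  have := le_abs_self (a - b)
  gcongr

theorem s15_abs {a b s : ℝ} (ha : 0 < a) (hb : 0 < b) (hs : 0 ≤ s) :
    |a ^ (-s) - b ^ (-s)| ≤ s * |a - b| * (a ^ (-s - 1) + b ^ (-s - 1)) := by
  have h1 := s15_pointwise ha hb hs
  have h2 := s15_pointwise hb ha hs
  rw [abs_sub_comm b a] at h2
  have h3 : 0 ≤ s * |a - b| := by positivity
  have h4 : 0 < a ^ (-s - 1) := Real.rpow_pos_of_pos ha _
  have h5 : 0 < b ^ (-s - 1) := Real.rpow_pos_of_pos hb _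
  rw [abs_le]
  constructor <;> nlinarith [mul_nonneg h3 h4.le, mul_nonneg h3 h5.le]

theorem s15_ball (n : ℕ) (hn : 3 ≤ n) (p : ℝ) (hp : -(n : ℝ) < p) :
    IntegrableOn (fun z : EuclideanSpace ℝ (Fin n) => ‖z‖ ^ p) (ball 0 1) := by
  refine integrableOn_ball_of_norm_le_rpow (C := 1) (α := -p) ?_ ?_ ?_ ?_
  · simp; omega
  · simp; linarith
  · refine Filter.Eventually.of_forall fun x => ?_
    simp [abs_of_nonneg (Real.rpow_nonneg (norm_nonneg x) p)]
  · exact (by fun_prop : Measurable fun z : EuclideanSpace ℝ (Fin n) => ‖z‖ ^ p).aestronglyMeasurable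

theorem s15_unif (n : ℕ) (hn : 3 ≤ n) (p : ℝ) (hp : -(n : ℝ) < p) (hp0 : p ≤ 0) :
    ∃ M : ℝ, 0 ≤ M ∧ ∀ x : EuclideanSpace ℝ (Fin n),
      IntegrableOn (fun y => ‖x - y‖ ^ p) (ball 0 1) ∧
      ∫ y in ball (0 : EuclideanSpace ℝ (Fin n)) 1, ‖x - y‖ ^ p ≤ M := by
  set h : EuclideanSpace ℝ (Fin n) → ℝ := (ball 0 1).indicator (fun z => ‖z‖ ^ p) with hh
  have hint : Integrable h := (s15_ball n hn p hp).integrable_indicator measurableSet_ball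
  have hnn : ∀ z, 0 ≤ h z := fun z => indicator_nonneg (fun z _ => Real.rpow_nonneg (norm_nonneg z) p) z
  have hle : ∀ z, ‖z‖ ^ p ≤ h z + 1 := by
    intro z
    by_cases hz : z ∈ ball (0 : EuclideanSpace ℝ (Fin n)) 1
    · simp [hh, indicator_of_mem hz]
    · have : 1 ≤ ‖z‖ := by simpa using hz
      have h1 := Real.rpow_le_one_of_one_le_of_nonpos this hp0
      linarith [hnn z]
  have hI : ∀ x : EuclideanSpace ℝ (Fin n), Integrable (fun y => h (x - y)) :=
    fun x => hint.comp_sub_left x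
  have hI2 : ∀ x : EuclideanSpace ℝ (Fin n),
      IntegrableOn (fun y => h (x - y) + 1) (ball 0 1) := fun x =>
    (hI x).integrableOn.add (integrableOn_const (by exact measure_ball_lt_top.ne))
  have hI3 : ∀ x : EuclideanSpace ℝ (Fin n),
      IntegrableOn (fun y => ‖x - y‖ ^ p) (ball 0 1) := by
    intro x
    refine (hI2 x).mono' ?_ ?_
    · exact (by fun_prop : Measurable fun z : EuclideanSpace ℝ (Fin n) =>
        ‖x - z‖ ^ p).aestronglyMeasurable
    · refine Filter.Eventually.of_forall fun y => ?_
      rw [Real.norm_of_nonneg (Real.rpow_nonneg (norm_nonneg _) p)]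
      exact hle _
  refine ⟨(∫ z, h z) + volume.real (ball (0 : EuclideanSpace ℝ (Fin n)) 1), ?_, ?_⟩
  · have : 0 ≤ ∫ z, h z := integral_nonneg hnn
    positivity
  · intro x
    refine ⟨hI3 x, ?_⟩
    calc ∫ y in ball (0 : EuclideanSpace ℝ (Fin n)) 1, ‖x - y‖ ^ p
        ≤ ∫ y in ball (0 : EuclideanSpace ℝ (Fin n)) 1, (h (x - y) + 1) :=
          setIntegral_mono (hI3 x) (hI2 x) fun y => hle _
      _ = (∫ y in ball (0 : EuclideanSpace ℝ (Fin n)) 1, h (x - y)) +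
          volume.real (ball (0 : EuclideanSpace ℝ (Fin n)) 1) := by
          rw [integral_add (hI x).integrableOn
            (integrableOn_const (by exact measure_ball_lt_top.ne))]
          simp
      _ ≤ _ := by
          gcongr
          rw [← integral_sub_left_eq_self h volume x]
          exact setIntegral_le_integral (hI x) (Filter.Eventually.of_forall fun y => hnn _)

theorem s15_rot (n : ℕ) (p : ℝ) (x x' : EuclideanSpace ℝ (Fin n)) (hx : ‖x‖ = ‖x'‖) :
    ∫ y in ball (0 : EuclideanSpace ℝ (Fin n)) 1, ‖x - y‖ ^ p =
    ∫ y in ball (0 : EuclideanSpace ℝ (Fin n)) 1, ‖x' - y‖ ^ p := by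
  set R := (ℝ ∙ (x - x'))ᗮ.reflection with hR
  have hRx : R x = x' := Submodule.reflection_sub hx
  have h1 := R.measurePreserving.setIntegral_preimage_emb
    R.toHomeomorph.measurableEmbedding (fun y => ‖x' - y‖ ^ p) (ball 0 1)
  rw [← h1]
  have h2 : R ⁻¹' ball 0 1 = ball 0 1 := by
    ext y; simp
  rw [h2]
  congr 1
  ext y
  rw [← hRx, ← map_sub, R.norm_map]

theorem s15_key (n : ℕ) (hn : 3 ≤ n) :
    ∃ C M c : ℝ, 0 < C ∧ ∀ x : EuclideanSpace ℝ (Fin n),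
      IntegrableOn (fun y => ‖x - y‖ ^ (2 - (n : ℝ))) (ball 0 1) ∧
      (∫ y in ball (0 : EuclideanSpace ℝ (Fin n)) 1, ‖x - y‖ ^ (2 - (n : ℝ))) ≤ M ∧
      (x ≠ 0 → |(∫ y in ball (0 : EuclideanSpace ℝ (Fin n)) 1, ‖x - y‖ ^ (2 - (n : ℝ))) - c|
        ≤ C * |‖x‖⁻¹ - 1|) := by
  have hn' : (3 : ℝ) ≤ n := by exact_mod_cast hn
  obtain ⟨M2, hM2, h2⟩ := s15_unif n hn (2 - (n : ℝ)) (by linarith) (by linarith)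
  obtain ⟨M1, hM1, h1⟩ := s15_unif n hn (1 - (n : ℝ)) (by linarith) (by linarith)
  set w : EuclideanSpace ℝ (Fin n) → ℝ :=
    fun x => ∫ y in ball (0 : EuclideanSpace ℝ (Fin n)) 1, ‖x - y‖ ^ (2 - (n : ℝ)) with hw
  have hw0 : ∀ x, 0 ≤ w x := fun x => integral_nonneg fun y => Real.rpow_nonneg (norm_nonneg _) _
  have : Nonempty (Fin n) := ⟨⟨0, by omega⟩⟩
  set L : ℝ := ((n : ℝ) - 2) * (2 * M1) with hL
  have hL0 : 0 ≤ L := by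
    have : 0 ≤ (n : ℝ) - 2 := by linarith
    positivity
  have hlip : ∀ x x' : EuclideanSpace ℝ (Fin n), |w x - w x'| ≤ L * ‖x - x'‖ := by
    intro x x'
    have e1 : w x - w x' = ∫ y in ball (0 : EuclideanSpace ℝ (Fin n)) 1,
        (‖x - y‖ ^ (2 - (n : ℝ)) - ‖x' - y‖ ^ (2 - (n : ℝ))) :=
      (integral_sub (h2 x).1 (h2 x').1).symm
    have hg : IntegrableOn (fun y => ((n : ℝ) - 2) * ‖x - x'‖ *
        (‖x - y‖ ^ (1 - (n : ℝ)) + ‖x' - y‖ ^ (1 - (n : ℝ)))) (ball 0 1) :=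
      ((h1 x).1.add (h1 x').1).const_mul _
    rw [e1, ← Real.norm_eq_abs]
    refine (norm_integral_le_of_norm_le hg ?_).trans ?_
    · have ae1 : ∀ᵐ y : EuclideanSpace ℝ (Fin n), y ≠ x := Measure.ae_ne volume x
      have ae2 : ∀ᵐ y : EuclideanSpace ℝ (Fin n), y ≠ x' := Measure.ae_ne volume x'
      refine ae_restrict_of_ae ?_
      filter_upwards [ae1, ae2] with y hy hy'
      have p1 : 0 < ‖x - y‖ := norm_pos_iff.2 (sub_ne_zero.2 hy.symm)
      have p2 : 0 < ‖x' - y‖ := norm_pos_iff.2 (sub_ne_zero.2 hy'.symm)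
      have := s15_abs p1 p2 (s := (n : ℝ) - 2) (by linarith)
      rw [show -((n : ℝ) - 2) - 1 = 1 - n by ring, show -((n : ℝ) - 2) = 2 - n by ring] at this
      rw [Real.norm_eq_abs]
      refine this.trans ?_
      have h3 : |‖x - y‖ - ‖x' - y‖| ≤ ‖x - x'‖ := by
        have := abs_norm_sub_norm_le (x - y) (x' - y)
        simpa using this
      have h4 : 0 ≤ (n : ℝ) - 2 := by linarith
      gcongr
    · rw [integral_const_mul, integral_add (h1 x).1 (h1 x').1]
      have h4 : 0 ≤ (n : ℝ) - 2 := by linarith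
      have h5 := (h1 x).2
      have h6 := (h1 x').2
      calc _ ≤ ((n : ℝ) - 2) * ‖x - x'‖ * (M1 + M1) := by gcongr
        _ = _ := by rw [hL]; ring
  set e : EuclideanSpace ℝ (Fin n) := EuclideanSpace.single ⟨0, by omega⟩ 1 with he
  have hen : ‖e‖ = 1 := by simp [he]
  refine ⟨2 * (L + M2) + 1, M2, w e, by positivity, fun x => ⟨(h2 x).1, (h2 x).2, fun hx => ?_⟩⟩
  change |w x - w e| ≤ _
  have hr : 0 < ‖x‖ := norm_pos_iff.2 hx
  have hA : 0 ≤ |‖x‖⁻¹ - 1| := abs_nonneg _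
  by_cases hr2 : ‖x‖ ≤ 2
  · have hwe : w e = w (‖x‖⁻¹ • x) := by
      apply s15_rot
      rw [hen, norm_smul, norm_inv, norm_norm, inv_mul_cancel₀ hr.ne']
    rw [hwe]
    have e2 : ‖x - ‖x‖⁻¹ • x‖ = ‖x‖ * |‖x‖⁻¹ - 1| := by
      have : x - ‖x‖⁻¹ • x = (1 - ‖x‖⁻¹) • x := by rw [sub_smul, one_smul]
      rw [this, norm_smul, Real.norm_eq_abs, abs_sub_comm, mul_comm]
    have := hlip x (‖x‖⁻¹ • x)
    rw [e2] at this
    calc _ ≤ L * (‖x‖ * |‖x‖⁻¹ - 1|) := this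
      _ ≤ L * (2 * |‖x‖⁻¹ - 1|) := by gcongr
      _ ≤ _ := by nlinarith [mul_nonneg hM2 hA]
  · push Not at hr2
    have h3 : ‖x‖⁻¹ ≤ 2⁻¹ := by gcongr
    have h4 : 1 / 2 ≤ |‖x‖⁻¹ - 1| := by
      rw [abs_sub_comm]
      refine le_trans ?_ (le_abs_self _)
      linarith
    have h5 : |w x - w e| ≤ M2 := by
      have a1 := hw0 x
      have a2 := hw0 e
      have a3 : w x ≤ M2 := (h2 x).2
      have a4 : w e ≤ M2 := (h2 e).2
      rw [abs_le]; constructor <;> linarith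
    nlinarith [mul_nonneg hL0 hA]

/-- For `n ≥ 3`: `∫_{B_1}∫ f_E(x)|x-y|^{2-n} dx dy ≤ C ∫ f_E(x)|x|^{-1} dx` with `C`
depending only on `n`. -/
theorem statement15 (n : ℕ) (hn : 3 ≤ n) :
    ∃ C : ℝ, 0 < C ∧ ∀ E : Set (EuclideanSpace ℝ (Fin n)), HasFinitePerimeter E →
      volume E = volume (ball (0 : EuclideanSpace ℝ (Fin n)) 1) →
      (∫ y in ball (0 : EuclideanSpace ℝ (Fin n)) 1,
          ∫ x, fE E x * ‖x - y‖ ^ (2 - (n : ℝ))) ≤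
        C * ∫ x, fE E x * ‖x‖⁻¹ := by
  obtain ⟨C, M, c, hC, hk⟩ := s15_key n hn
  have hn' : (3 : ℝ) ≤ n := by exact_mod_cast hn
  have : Nonempty (Fin n) := ⟨⟨0, by omega⟩⟩
  refine ⟨C, hC, fun E hE hvol => ?_⟩
  have hEm : MeasurableSet E := hE.1
  set w : EuclideanSpace ℝ (Fin n) → ℝ :=
    fun x => ∫ y in ball (0 : EuclideanSpace ℝ (Fin n)) 1, ‖x - y‖ ^ (2 - (n : ℝ)) with hw
  have hw0 : ∀ x, 0 ≤ w x := fun x => integral_nonneg fun y => Real.rpow_nonneg (norm_nonneg _) _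
  have hBfin : volume (ball (0 : EuclideanSpace ℝ (Fin n)) 1) ≠ ⊤ := measure_ball_lt_top.ne
  have hIB : Integrable ((ball (0 : EuclideanSpace ℝ (Fin n)) 1).indicator (1 : EuclideanSpace ℝ (Fin n) → ℝ)) :=
    (integrable_indicator_iff measurableSet_ball).2 (integrableOn_const (C := (1 : ℝ)) hBfin)
  have hIE : Integrable (E.indicator (1 : EuclideanSpace ℝ (Fin n) → ℝ)) :=
    (integrable_indicator_iff hEm).2 (integrableOn_const (C := (1 : ℝ)) (by rw [hvol]; exact hBfin))
  have hf : Integrable (fE E) := hIB.sub hIE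
  have hfm : Measurable (fE E) :=
    (measurable_one.indicator measurableSet_ball).sub (measurable_one.indicator hEm)
  have hf0 : ∫ x, fE E x = 0 := by
    have : ∫ x, fE E x = (∫ x, (ball (0 : EuclideanSpace ℝ (Fin n)) 1).indicator (1 : EuclideanSpace ℝ (Fin n) → ℝ) x) -
      ∫ x, E.indicator (1 : EuclideanSpace ℝ (Fin n) → ℝ) x := integral_sub hIB hIE
    rw [this, integral_indicator_one measurableSet_ball, integral_indicator_one hEm]
    simp [Measure.real, hvol]
  have hkm : Measurable (fun q : EuclideanSpace ℝ (Fin n) × EuclideanSpace ℝ (Fin n) =>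
      ‖q.1 - q.2‖ ^ (2 - (n : ℝ))) := by fun_prop
  have hwm : AEStronglyMeasurable w volume :=
    (hkm.stronglyMeasurable.integral_prod_right
      (ν := volume.restrict (ball (0 : EuclideanSpace ℝ (Fin n)) 1))).aestronglyMeasurable
  have hfw : Integrable (fun x => fE E x * w x) := by
    refine hf.mul_bdd (c := M) hwm (Filter.Eventually.of_forall fun x => ?_)
    rw [Real.norm_of_nonneg (hw0 x)]
    exact (hk x).2.1
  have hprod : Integrable (Function.uncurry fun x y : EuclideanSpace ℝ (Fin n) =>
      fE E x * ‖x - y‖ ^ (2 - (n : ℝ)))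
      (volume.prod (volume.restrict (ball (0 : EuclideanSpace ℝ (Fin n)) 1))) := by
    rw [integrable_prod_iff]
    · constructor
      · exact Filter.Eventually.of_forall fun x => (hk x).1.const_mul (fE E x)
      · have : (fun x => ∫ y in ball (0 : EuclideanSpace ℝ (Fin n)) 1,
            ‖Function.uncurry (fun x y : EuclideanSpace ℝ (Fin n) =>
              fE E x * ‖x - y‖ ^ (2 - (n : ℝ))) (x, y)‖) = fun x => ‖fE E x * w x‖ := by
          ext x
          simp only [Function.uncurry_apply_pair, norm_mul]
          rw [integral_const_mul, Real.norm_of_nonneg (hw0 x)]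
          congr 1
          refine integral_congr_ae (Filter.Eventually.of_forall fun y => ?_)
          exact Real.norm_of_nonneg (Real.rpow_nonneg (norm_nonneg _) _)
        rw [this]
        exact hfw.norm
    · exact ((hfm.comp measurable_fst).mul hkm).aestronglyMeasurable
  have hswap : (∫ y in ball (0 : EuclideanSpace ℝ (Fin n)) 1,
      ∫ x, fE E x * ‖x - y‖ ^ (2 - (n : ℝ))) = ∫ x, fE E x * w x := by
    rw [← integral_integral_swap hprod]
    refine integral_congr_ae (Filter.Eventually.of_forall fun x => ?_)
    exact integral_const_mul _ _
  have hinv : Integrable (fun x : EuclideanSpace ℝ (Fin n) => fE E x * ‖x‖⁻¹) := by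
    have hb : Integrable ((ball (0 : EuclideanSpace ℝ (Fin n)) 1).indicator
        (fun z => ‖z‖ ^ (-1 : ℝ))) :=
      (s15_ball n hn (-1) (by linarith)).integrable_indicator measurableSet_ball
    refine (hb.add hf.norm).mono' ?_ ?_
    · exact (hfm.mul measurable_norm.inv).aestronglyMeasurable
    · refine Filter.Eventually.of_forall fun x => ?_
      have hf1 : |fE E x| ≤ 1 := by
        unfold fE
        by_cases h1 : x ∈ ball (0 : EuclideanSpace ℝ (Fin n)) 1 <;> by_cases h2 : x ∈ E <;>
          simp [h1, h2, -mem_ball]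
      have hi : 0 ≤ ‖x‖⁻¹ := by positivity
      simp only [Pi.add_apply, norm_mul, Real.norm_eq_abs, abs_of_nonneg hi]
      by_cases hx : x ∈ ball (0 : EuclideanSpace ℝ (Fin n)) 1
      · rw [indicator_of_mem hx, Real.rpow_neg_one]
        nlinarith [abs_nonneg (fE E x)]
      · rw [indicator_of_notMem hx]
        have h1 : 1 ≤ ‖x‖ := by simpa using hx
        have h2 : ‖x‖⁻¹ ≤ 1 := inv_le_one_of_one_le₀ h1
        nlinarith [abs_nonneg (fE E x)]
  rw [hswap]
  have hpos : 0 ≤ ∫ x, (C * (fE E x * ‖x‖⁻¹) - fE E x * w x - (C - c) * fE E x) := by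
    refine integral_nonneg_of_ae ?_
    have ae0 : ∀ᵐ y : EuclideanSpace ℝ (Fin n), y ≠ 0 := Measure.ae_ne volume 0
    filter_upwards [ae0] with x hx
    have h1 : |w x - c| ≤ C * |‖x‖⁻¹ - 1| := (hk x).2.2 hx
    have hr : 0 < ‖x‖ := norm_pos_iff.2 hx
    have e : C * (fE E x * ‖x‖⁻¹) - fE E x * w x - (C - c) * fE E x =
      fE E x * (C * (‖x‖⁻¹ - 1) - (w x - c)) := by ring
    simp only [Pi.zero_apply]
    rw [e]
    by_cases hb : x ∈ ball (0 : EuclideanSpace ℝ (Fin n)) 1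
    · have hf1 : 0 ≤ fE E x := by
        unfold fE
        by_cases h2 : x ∈ E <;> simp [hb, h2, -mem_ball]
      have h1' : ‖x‖ < 1 := by simpa using hb
      have h2 : 1 ≤ ‖x‖⁻¹ := (one_le_inv₀ hr).2 h1'.le
      rw [abs_of_nonneg (sub_nonneg.2 h2)] at h1
      exact mul_nonneg hf1 (by linarith [le_abs_self (w x - c)])
    · have hf1 : fE E x ≤ 0 := by
        unfold fE
        by_cases h2 : x ∈ E <;> simp [hb, h2, -mem_ball]
      have h1' : 1 ≤ ‖x‖ := by simpa using hb
      have h2 : ‖x‖⁻¹ ≤ 1 := inv_le_one_of_one_le₀ h1'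
      rw [abs_of_nonpos (sub_nonpos.2 h2)] at h1
      exact mul_nonneg_of_nonpos_of_nonpos hf1 (by linarith [neg_abs_le (w x - c)])
  have hsub : Integrable (fun x => C * (fE E x * ‖x‖⁻¹) - fE E x * w x) :=
    (hinv.const_mul C).sub hfw
  rw [integral_sub hsub (hf.const_mul _),
    integral_sub (hinv.const_mul C) hfw, integral_const_mul, integral_const_mul, hf0] at hpos
  linarith
end

section
/- In the plane n = 2 the analogue of the minimization problem fails: for every m > 0, the infimum of P(F) + ∫_{ℝ²}∫_{ℝ²} χ_F(x)χ_F(y) log(1/|x−y|) dy dx over sets of finite perimeter F ⊂ ℝ² with |F| = m equals −∞. In particular, considering F_R equal to the union of two disjoint disks of area m/2 whose centers are at distance R, the energy tends to −∞ as R → ∞. -/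
open MeasureTheory Metric Set

/-- Two disjoint disks of area `m/2` each, whose centers are at distance `R`. -/
noncomputable def twoDisks (m R : ℝ) : Set (EuclideanSpace ℝ (Fin 2)) :=
  ball (0 : EuclideanSpace ℝ (Fin 2)) (Real.sqrt (m / (2 * Real.pi))) ∪
    ball (R • EuclideanSpace.single (0 : Fin 2) (1 : ℝ)) (Real.sqrt (m / (2 * Real.pi)))

lemma vol_ball_real (c : EuclideanSpace ℝ (Fin 2)) {r : ℝ} (hr : 0 ≤ r) :
    volume.real (ball c r) = r ^ 2 * Real.pi := by
  rw [measureReal_def, EuclideanSpace.volume_ball_fin_two, ENNReal.toReal_mul, ENNReal.toReal_pow,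
    ENNReal.toReal_ofReal hr, ENNReal.toReal_ofReal Real.pi_pos.le]

lemma ball_lineDeriv_le (c : EuclideanSpace ℝ (Fin 2)) {r : ℝ} (hr : 0 < r) {f : EuclideanSpace ℝ (Fin 2) → ℝ} {C : NNReal}
    (hf : LipschitzWith C f) (hc : HasCompactSupport f) (hb : ∀ x, |f x| ≤ 1)
    (v : EuclideanSpace ℝ (Fin 2)) (hv : ‖v‖ = 1) :
    ∫ x in ball c r, lineDeriv ℝ f x v ≤ 4 * Real.pi * r := by
  set g : EuclideanSpace ℝ (Fin 2) → ℝ := (ball c r).indicator 1 with hg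
  have hgi : Integrable g volume :=
    (integrable_indicator_iff measurableSet_ball).2 (integrableOn_const measure_ball_lt_top.ne)
  have hlim := hf.integral_inv_smul_sub_mul_tendsto_integral_lineDeriv_mul (μ := volume) hgi v
  have e1 : ∫ x, lineDeriv ℝ f x v * g x = ∫ x in ball c r, lineDeriv ℝ f x v := by
    rw [← integral_indicator measurableSet_ball]
    congr 1; ext x
    by_cases hx : x ∈ ball c r <;> simp [hg, hx]
  rw [e1] at hlim
  refine le_of_tendsto hlim ?_
  have hlt : ∀ᶠ t : ℝ in nhdsWithin 0 (Ioi 0), t < r :=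
    nhdsWithin_le_nhds (Iio_mem_nhds hr)
  filter_upwards [hlt, self_mem_nhdsWithin] with t htr ht0
  have ht0 : 0 < t := ht0
  have hfi : Integrable f volume := hf.continuous.integrable_of_hasCompactSupport hc
  have hbdg : ∀ x, ‖g x‖ ≤ 1 := by
    intro x; by_cases hx : x ∈ ball c r <;> simp [hg, hx]
  have i1 : Integrable (fun x => f (x + t • v) * g x) volume :=
    (hfi.comp_add_right (t • v)).mul_bdd (c := 1) hgi.aestronglyMeasurable
      (Filter.Eventually.of_forall hbdg)
  have i2 : Integrable (fun x => f x * g x) volume :=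
    hfi.mul_bdd (c := 1) hgi.aestronglyMeasurable (Filter.Eventually.of_forall hbdg)
  have hgi' : Integrable (fun x => g (x + t • (-v))) volume := hgi.comp_add_right _
  have i3 : Integrable (fun x => f x * g (x + t • (-v))) volume :=
    hfi.mul_bdd (c := 1) hgi'.aestronglyMeasurable (Filter.Eventually.of_forall fun x => hbdg _)
  have S3 : ∫ x, f (x + t • v) * g x = ∫ x, f x * g (x + t • (-v)) := by
    rw [← integral_add_right_eq_self _ (t • (-v))]; simp
  have S2 : ∫ x, (t⁻¹ • (f (x + t • v) - f x)) * g x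
      = t⁻¹ * ∫ x, f x * (g (x + t • (-v)) - g x) := by
    simp only [smul_eq_mul, mul_assoc, integral_const_mul]
    simp only [sub_mul, mul_sub (f _)]
    rw [integral_sub i1 i2, integral_sub i3 i2, S3]
  rw [S2]
  set A : Set (EuclideanSpace ℝ (Fin 2)) := ball c (r + t) \ ball c (r - t) with hA
  have hAm : MeasurableSet A := measurableSet_ball.diff measurableSet_ball
  have hAv : volume.real A = 4 * Real.pi * r * t := by
    rw [hA, measureReal_sdiff (ball_subset_ball (by linarith)) measurableSet_ball,
      vol_ball_real c (by linarith), vol_ball_real c (by linarith)]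
    ring
  have hAfin : volume A ≠ ⊤ :=
    ne_top_of_le_ne_top (measure_ball_lt_top.ne : volume (ball c (r + t)) ≠ ⊤) (measure_mono sdiff_subset)
  have hle : ∫ x, f x * (g (x + t • (-v)) - g x) ≤ ∫ x, A.indicator (fun _ => (1:ℝ)) x := by
    refine integral_mono ?_ ?_ ?_
    · simp only [mul_sub]; exact i3.sub i2
    · exact (integrable_indicator_iff hAm).2 (integrableOn_const hAfin)
    · intro x
      have hfx := abs_le.1 (hb x)
      have n1 : ‖x + t • (-v) - c‖ ≤ ‖x - c‖ + t := by
        have : x + t • (-v) - c = (x - c) - t • v := by simp; abel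
        rw [this]
        refine (norm_sub_le _ _).trans ?_
        rw [norm_smul, hv, Real.norm_of_nonneg ht0.le, mul_one]
      have n2 : ‖x - c‖ ≤ ‖x + t • (-v) - c‖ + t := by
        have : x - c = (x + t • (-v) - c) + t • v := by simp; abel
        conv_lhs => rw [this]
        refine (norm_add_le _ _).trans ?_
        rw [norm_smul, hv, Real.norm_of_nonneg ht0.le, mul_one]
      dsimp only
      by_cases h1 : x ∈ ball c r <;> by_cases h2 : x + t • (-v) ∈ ball c r
      · rw [hg, indicator_of_mem h1, indicator_of_mem h2]
        simp only [Pi.one_apply, sub_self, mul_zero]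
        exact indicator_nonneg (fun _ _ => zero_le_one) _
      · have hxA : x ∈ A := by
          simp only [hA, mem_sdiff, mem_ball, dist_eq_norm] at *
          constructor <;> linarith
        rw [hg, indicator_of_mem h1, indicator_of_notMem h2, indicator_of_mem hxA]
        simp only [Pi.one_apply]; linarith
      · have hxA : x ∈ A := by
          simp only [hA, mem_sdiff, mem_ball, dist_eq_norm] at *
          constructor <;> linarith
        rw [hg, indicator_of_mem h2, indicator_of_notMem h1, indicator_of_mem hxA]
        simp only [Pi.one_apply]; linarith
      · rw [hg, indicator_of_notMem h1, indicator_of_notMem h2]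
        simp only [sub_self, mul_zero]
        exact indicator_nonneg (fun _ _ => zero_le_one) _
  rw [integral_indicator hAm, setIntegral_const, hAv, smul_eq_mul, mul_one] at hle
  calc t⁻¹ * ∫ x, f x * (g (x + t • (-v)) - g x) ≤ t⁻¹ * (4 * Real.pi * r * t) := by gcongr
    _ = 4 * Real.pi * r := by field_simp

lemma ball_vdiv_le (c : EuclideanSpace ℝ (Fin 2)) {r : ℝ} (hr : 0 < r) {φ : EuclideanSpace ℝ (Fin 2) → EuclideanSpace ℝ (Fin 2)}
    (h1 : ContDiff ℝ 1 φ) (h2 : HasCompactSupport φ) (h3 : ∀ x, ‖φ x‖ ≤ 1) :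
    ∫ x in ball c r, vdiv φ x ≤ 8 * Real.pi * r := by
  have hcomp : ∀ i : Fin 2, ContDiff ℝ 1 (fun x => φ x i) := fun i => by fun_prop
  have hcs : ∀ i : Fin 2, HasCompactSupport (fun x => φ x i) := fun i =>
    h2.comp_left (g := fun y : EuclideanSpace ℝ (Fin 2) => y i) rfl
  have hld : ∀ (i : Fin 2) (x : EuclideanSpace ℝ (Fin 2)), fderiv ℝ φ x (EuclideanSpace.single i 1) i
      = lineDeriv ℝ (fun x => φ x i) x (EuclideanSpace.single i 1) := by
    intro i x
    have hd : HasFDerivAt φ (fderiv ℝ φ x) x := (h1.differentiable (by simp) x).hasFDerivAt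
    have hd2 := ((EuclideanSpace.proj i : EuclideanSpace ℝ (Fin 2) →L[ℝ] ℝ).hasFDerivAt
      (x := φ x)).comp x hd
    exact (hd2.hasLineDerivAt _).lineDeriv.symm
  have key : ∀ i : Fin 2, ∫ x in ball c r, fderiv ℝ φ x (EuclideanSpace.single i 1) i
      ≤ 4 * Real.pi * r := by
    intro i
    simp only [hld]
    obtain ⟨C, hC⟩ := (hcomp i).lipschitzWith_of_hasCompactSupport (hcs i) (by simp)
    refine ball_lineDeriv_le c hr hC (hcs i) (fun x => ?_) _ (by simp)
    exact (PiLp.norm_apply_le (φ x) i).trans (h3 x)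
  have hint : ∀ i : Fin 2, IntegrableOn
      (fun x => fderiv ℝ φ x (EuclideanSpace.single i 1) i) (ball c r) := by
    intro i
    have hcont : Continuous (fun x => fderiv ℝ φ x (EuclideanSpace.single i 1) i) := by
      have := h1.continuous_fderiv (by simp)
      fun_prop
    exact (hcont.locallyIntegrable.integrableOn_isCompact
      (isCompact_closedBall c r)).mono_set ball_subset_closedBall
  simp only [vdiv]
  rw [integral_finsetSum _ (fun i _ => hint i), Fin.sum_univ_two]
  have := key 0; have := key 1
  linarith

lemma vdiv_integrableOn (c : EuclideanSpace ℝ (Fin 2)) (r : ℝ) {φ : EuclideanSpace ℝ (Fin 2) → EuclideanSpace ℝ (Fin 2)} (h1 : ContDiff ℝ 1 φ) :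
    IntegrableOn (vdiv φ) (ball c r) := by
  have hcont : Continuous (vdiv φ) := by
    have := h1.continuous_fderiv (by simp)
    unfold vdiv
    fun_prop
  exact (hcont.locallyIntegrable.integrableOn_isCompact
      (isCompact_closedBall c r)).mono_set ball_subset_closedBall

lemma perimVals_le {c d : EuclideanSpace ℝ (Fin 2)} {r : ℝ} (hr : 0 < r) (hd : Disjoint (ball c r) (ball d r)) :
    ∀ a ∈ perimVals (ball c r ∪ ball d r), a ≤ 16 * Real.pi * r := by
  rintro a ⟨φ, h1, h2, h3, rfl⟩
  rw [setIntegral_union hd measurableSet_ball (vdiv_integrableOn c r h1)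
    (vdiv_integrableOn d r h1)]
  have := ball_vdiv_le c hr h1 h2 h3
  have := ball_vdiv_le d hr h1 h2 h3
  linarith

lemma perimVals_nonempty (F : Set (EuclideanSpace ℝ (Fin 2))) : (perimVals F).Nonempty :=
  ⟨_, 0, contDiff_const, HasCompactSupport.zero, by simp, rfl⟩

/-- The positive part of the logarithmic kernel. -/
noncomputable def kpos (z : EuclideanSpace ℝ (Fin 2)) : ℝ := max (Real.log (1 / ‖z‖)) 0

lemma kpos_integrable : Integrable kpos volume := by
  have : Integrable (fun z : EuclideanSpace ℝ (Fin 2) => (fun t : ℝ => max (Real.log (1 / t)) 0) ‖z‖) volume := by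
    refine (integrable_fun_norm_addHaar volume (f := fun t : ℝ => max (Real.log (1 / t)) 0)).2 ?_
    have hsupp : IntegrableOn ((Ioc (0:ℝ) 1).indicator (fun _ => (1:ℝ))) (Ioi 0) :=
      ((integrable_indicator_iff measurableSet_Ioc).2
        (integrableOn_const (by simp))).integrableOn
    refine Integrable.mono' hsupp ?_ ?_
    · refine Measurable.aestronglyMeasurable ?_
      fun_prop
    · refine (ae_restrict_iff' measurableSet_Ioi).2 (Filter.Eventually.of_forall fun t ht => ?_)
      have ht : 0 < t := ht
      simp only [finrank_euclideanSpace, Fintype.card_fin, smul_eq_mul]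
      norm_num
      by_cases h : t ≤ 1
      · rw [indicator_of_mem (show t ∈ Ioc (0:ℝ) 1 from ⟨ht, h⟩)]
        have hl : -Real.log t ≤ 1 / t := by
          have := Real.log_le_sub_one_of_pos (x := 1 / t) (by positivity)
          rw [one_div, Real.log_inv] at this
          rw [one_div]; linarith
        have hm0 : 0 ≤ max (-Real.log t) 0 := le_max_right _ _
        have : max (-Real.log t) 0 ≤ 1 / t := max_le hl (by positivity)
        rw [abs_of_pos ht, abs_of_nonneg hm0]
        calc t * max (-Real.log t) 0 ≤ t * (1 / t) := by gcongr
          _ = 1 := by field_simp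
      · have : max (-Real.log t) 0 = 0 :=
          max_eq_right (by have := Real.log_nonneg (not_le.1 h).le; linarith)
        rw [this]; simp
        exact indicator_nonneg (fun _ _ => zero_le_one) _
  exact this

lemma abs_log_le (z : EuclideanSpace ℝ (Fin 2)) : |Real.log (1 / ‖z‖)| ≤ kpos z + ‖z‖ := by
  have h0 : 0 ≤ kpos z := le_max_right _ _
  have h1 : Real.log (1 / ‖z‖) ≤ kpos z := le_max_left _ _
  have h2 : Real.log ‖z‖ ≤ ‖z‖ := Real.log_le_self (norm_nonneg z)
  have h3 : Real.log (1 / ‖z‖) = - Real.log ‖z‖ := by rw [one_div, Real.log_inv]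
  rw [abs_le]
  constructor <;> linarith [norm_nonneg z]

lemma kpos_shift (x : EuclideanSpace ℝ (Fin 2)) : Integrable (fun y => kpos (x - y)) volume :=
  kpos_integrable.comp_sub_left x

lemma log_meas : Measurable (fun p : EuclideanSpace ℝ (Fin 2) × EuclideanSpace ℝ (Fin 2) => Real.log (1 / ‖p.1 - p.2‖)) := by
  fun_prop

lemma log_intOn (x : EuclideanSpace ℝ (Fin 2)) {F : Set (EuclideanSpace ℝ (Fin 2))} (hF : MeasurableSet F) (hfin : volume F ≠ ⊤)
    {D : ℝ} (hD : ∀ y ∈ F, ‖x - y‖ ≤ D) :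
    IntegrableOn (fun y => Real.log (1 / ‖x - y‖)) F := by
  have hdom : IntegrableOn (fun y => kpos (x - y) + D) F :=
    (kpos_shift x).integrableOn.add (integrableOn_const hfin)
  refine Integrable.mono' hdom ?_ ?_
  · refine Measurable.aestronglyMeasurable ?_
    fun_prop
  · refine (ae_restrict_iff' hF).2 (Filter.Eventually.of_forall fun y hy => ?_)
    have := abs_log_le (x - y)
    have := hD y hy
    rw [Real.norm_eq_abs]; linarith

lemma setInt_kpos_le (x : EuclideanSpace ℝ (Fin 2)) (F : Set (EuclideanSpace ℝ (Fin 2))) :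
    ∫ y in F, kpos (x - y) ≤ ∫ z, kpos z := by
  rw [← integral_sub_left_eq_self kpos volume x]
  exact setIntegral_le_integral (kpos_shift x)
    (Filter.Eventually.of_forall fun y => le_max_right _ _)

lemma inner_norm_le (x : EuclideanSpace ℝ (Fin 2)) {F : Set (EuclideanSpace ℝ (Fin 2))} (hF : MeasurableSet F) (hfin : volume F ≠ ⊤)
    {D : ℝ} (hD : ∀ y ∈ F, ‖x - y‖ ≤ D) :
    ‖∫ y in F, Real.log (1 / ‖x - y‖)‖ ≤ (∫ z, kpos z) + volume.real F * D := by
  have hdom : IntegrableOn (fun y => kpos (x - y) + D) F :=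
    (kpos_shift x).integrableOn.add (integrableOn_const hfin)
  refine (norm_integral_le_of_norm_le hdom ?_).trans ?_
  · refine (ae_restrict_iff' hF).2 (Filter.Eventually.of_forall fun y hy => ?_)
    have := abs_log_le (x - y)
    have := hD y hy
    rw [Real.norm_eq_abs]; linarith
  · rw [integral_add (kpos_shift x).integrableOn (integrableOn_const hfin), setIntegral_const,
      smul_eq_mul]
    have := setInt_kpos_le x F
    linarith

/-- Half of the inner estimate: one disk near, the other one far. -/
lemma inner_le (x c d : EuclideanSpace ℝ (Fin 2)) {r L D : ℝ} (hL : 0 < L) (hr : 0 < r)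
    (hd : Disjoint (ball c r) (ball d r))
    (hDc : ∀ y ∈ ball c r ∪ ball d r, ‖x - y‖ ≤ D)
    (hfar : ∀ y ∈ ball d r, L ≤ ‖x - y‖) :
    ∫ y in ball c r ∪ ball d r, Real.log (1 / ‖x - y‖)
      ≤ (∫ z, kpos z) - r ^ 2 * Real.pi * Real.log L := by
  have ic := log_intOn x (measurableSet_ball (x := c) (ε := r)) measure_ball_lt_top.ne
    (fun y hy => hDc y (Or.inl hy))
  have id := log_intOn x (measurableSet_ball (x := d) (ε := r)) measure_ball_lt_top.ne
    (fun y hy => hDc y (Or.inr hy))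
  rw [setIntegral_union hd measurableSet_ball ic id]
  have h1 : ∫ y in ball c r, Real.log (1 / ‖x - y‖) ≤ ∫ z, kpos z :=
    (setIntegral_mono ic (kpos_shift x).integrableOn (fun y => le_max_left _ _)).trans
      (setInt_kpos_le x _)
  have h2 : ∫ y in ball d r, Real.log (1 / ‖x - y‖) ≤ ∫ y in ball d r, (- Real.log L) := by
    refine setIntegral_mono_on id (integrableOn_const measure_ball_lt_top.ne) measurableSet_ball
      fun y hy => ?_
    rw [one_div, Real.log_inv]
    exact neg_le_neg (Real.log_le_log hL (hfar y hy))
  rw [setIntegral_const, vol_ball_real d hr.le, smul_eq_mul] at h2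
  linarith

lemma energy_le (c d : EuclideanSpace ℝ (Fin 2)) {r L : ℝ} (hL : 0 < L) (hr : 0 < r) (hcd : ‖c - d‖ = L + 2 * r) :
    ∫ x in ball c r ∪ ball d r, ∫ y in ball c r ∪ ball d r, Real.log (1 / ‖x - y‖)
      ≤ 2 * (r ^ 2 * Real.pi) * ((∫ z, kpos z) - r ^ 2 * Real.pi * Real.log L) := by
  have hd : Disjoint (ball c r) (ball d r) := by
    apply ball_disjoint_ball
    rw [dist_eq_norm, hcd]; linarith
  set F := ball c r ∪ ball d r with hF
  have hFm : MeasurableSet F := measurableSet_ball.union measurableSet_ball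
  have hFfin : volume F ≠ ⊤ := measure_union_ne_top measure_ball_lt_top.ne measure_ball_lt_top.ne
  have hvF : volume.real F = 2 * (r ^ 2 * Real.pi) := by
    rw [hF, measureReal_union hd measurableSet_ball measure_ball_lt_top.ne measure_ball_lt_top.ne, vol_ball_real c hr.le, vol_ball_real d hr.le]; ring
  have hdiam : ∀ x ∈ F, ∀ y ∈ F, ‖x - y‖ ≤ L + 4 * r := by
    have hdc : dist c d = L + 2 * r := by rw [dist_eq_norm, hcd]
    have hdc' : dist d c = L + 2 * r := by rw [dist_comm, hdc]
    intro x hx y hy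
    rw [← dist_eq_norm]
    rcases hx with hx | hx <;> rcases hy with hy | hy <;> rw [mem_ball] at hx hy
    · have := dist_triangle_right x y c; linarith
    · have := dist_triangle4_right x c y d; have := dist_triangle4 x c d y
      rw [dist_comm d y] at this; linarith
    · have := dist_triangle4 x d c y
      rw [dist_comm c y] at this; linarith
    · have := dist_triangle_right x y d; linarith
  have hfar : ∀ x ∈ ball c r, ∀ y ∈ ball d r, L ≤ ‖x - y‖ := by
    intro x hx y hy
    rw [mem_ball] at hx hy
    rw [← dist_eq_norm] at hcd ⊢
    have := dist_triangle4 c x y d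
    rw [dist_comm c x] at this; linarith
  have hmeas : StronglyMeasurable (fun x : EuclideanSpace ℝ (Fin 2) => ∫ y in F, Real.log (1 / ‖x - y‖)) :=
    log_meas.stronglyMeasurable.integral_prod_right'
  have hint : IntegrableOn (fun x : EuclideanSpace ℝ (Fin 2) => ∫ y in F, Real.log (1 / ‖x - y‖)) F := by
    refine Integrable.mono' (g := fun _ => (∫ z, kpos z) + volume.real F * (L + 4 * r))
      (integrableOn_const hFfin) hmeas.aestronglyMeasurable ?_
    refine (ae_restrict_iff' hFm).2 (Filter.Eventually.of_forall fun x hx => ?_)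
    exact inner_norm_le x hFm hFfin (hdiam x hx)
  have hle : ∫ x in F, ∫ y in F, Real.log (1 / ‖x - y‖)
      ≤ ∫ x in F, ((∫ z, kpos z) - r ^ 2 * Real.pi * Real.log L) := by
    refine setIntegral_mono_on hint (integrableOn_const hFfin) hFm fun x hx => ?_
    rcases hx with hx' | hx'
    · exact inner_le x c d hL hr hd (hdiam x (Or.inl hx')) (hfar x hx')
    · rw [hF, union_comm]
      refine inner_le x d c (D := L + 4 * r) hL hr hd.symm ?_ ?_
      · rw [union_comm]; exact hdiam x (Or.inr hx')
      · intro y hy; rw [norm_sub_rev]; exact hfar y hy x hx'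
  rwa [setIntegral_const, hvF, smul_eq_mul] at hle

lemma statement16_aux (m : ℝ) (hm : 0 < m) :
    Filter.Tendsto
        (fun R : ℝ => perimeter (twoDisks m R) +
          ∫ x in twoDisks m R, ∫ y in twoDisks m R, Real.log (1 / ‖x - y‖))
        Filter.atTop Filter.atBot ∧
      ∀ᶠ R : ℝ in Filter.atTop, HasFinitePerimeter (twoDisks m R) ∧
        volume (twoDisks m R) = ENNReal.ofReal m := by
  set r := Real.sqrt (m / (2 * Real.pi)) with hrdef
  have hpi := Real.pi_pos
  have hr : 0 < r := Real.sqrt_pos.2 (by positivity)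
  have hr2 : r ^ 2 * Real.pi = m / 2 := by
    rw [hrdef, Real.sq_sqrt (by positivity)]; field_simp
  have hcd : ∀ R : ℝ, 2 * r < R →
      ‖(0 : EuclideanSpace ℝ (Fin 2)) - R • EuclideanSpace.single (0 : Fin 2) (1 : ℝ)‖ = (R - 2 * r) + 2 * r := by
    intro R hR
    rw [zero_sub, norm_neg, norm_smul, Real.norm_of_nonneg (by linarith)]
    simp
  have hdisj : ∀ R : ℝ, 2 * r < R →
      Disjoint (ball (0 : EuclideanSpace ℝ (Fin 2)) r) (ball (R • EuclideanSpace.single (0 : Fin 2) (1 : ℝ)) r) := by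
    intro R hR
    apply ball_disjoint_ball
    rw [dist_eq_norm, hcd R hR]; linarith
  constructor
  · have hbound : ∀ᶠ R : ℝ in Filter.atTop, perimeter (twoDisks m R) +
          ∫ x in twoDisks m R, ∫ y in twoDisks m R, Real.log (1 / ‖x - y‖) ≤
          (16 * Real.pi * r + m * ∫ z, kpos z) + -(m * (m / 2) * Real.log (R - 2 * r)) := by
      filter_upwards [Filter.eventually_gt_atTop (2 * r)] with R hR
      have h1 : perimeter (twoDisks m R) ≤ 16 * Real.pi * r :=
        csSup_le (perimVals_nonempty _) (perimVals_le hr (hdisj R hR))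
      have h2 := energy_le (0 : EuclideanSpace ℝ (Fin 2)) (R • EuclideanSpace.single (0 : Fin 2) (1 : ℝ))
        (L := R - 2 * r) (by linarith) hr (hcd R hR)
      rw [hr2] at h2
      have h3 : ∫ x in twoDisks m R, ∫ y in twoDisks m R, Real.log (1 / ‖x - y‖) ≤
        2 * (m / 2) * ((∫ z, kpos z) - m / 2 * Real.log (R - 2 * r)) := h2
      calc _ ≤ 16 * Real.pi * r + 2 * (m / 2) * ((∫ z, kpos z) - m / 2 * Real.log (R - 2 * r)) :=
            add_le_add h1 h3
        _ = _ := by ring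
    refine Filter.tendsto_atBot_mono' _ hbound ?_
    refine Filter.tendsto_atBot_add_const_left _ _ ?_
    refine Filter.tendsto_neg_atTop_atBot.comp ?_
    refine Filter.Tendsto.const_mul_atTop (by positivity) ?_
    exact Real.tendsto_log_atTop.comp (Filter.tendsto_atTop_add_const_right _ _ Filter.tendsto_id)
  · filter_upwards [Filter.eventually_gt_atTop (2 * r)] with R hR
    refine ⟨⟨measurableSet_ball.union measurableSet_ball, _, perimVals_le hr (hdisj R hR)⟩, ?_⟩
    have hb : ∀ c : EuclideanSpace ℝ (Fin 2), volume (ball c r) = ENNReal.ofReal (m / 2) := by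
      intro c
      rw [← hr2, ← vol_ball_real c hr.le, measureReal_def, ENNReal.ofReal_toReal measure_ball_lt_top.ne]
    unfold twoDisks
    rw [measure_union (hdisj R hR) measurableSet_ball, hb, hb,
      ← ENNReal.ofReal_add (by positivity) (by positivity), add_halves]

/-- In the plane the analogous problem with the logarithmic potential fails: the
infimum of the energy is `-∞`, and in particular the energy of two disks of area
`m/2` at distance `R` tends to `-∞` as `R → ∞`. -/
theorem statement16 (m : ℝ) (hm : 0 < m) :
    (∀ c : ℝ, ∃ F : Set (EuclideanSpace ℝ (Fin 2)), HasFinitePerimeter F ∧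
        volume F = ENNReal.ofReal m ∧
        perimeter F + (∫ x in F, ∫ y in F, Real.log (1 / ‖x - y‖)) < c) ∧
      Filter.Tendsto
        (fun R : ℝ => perimeter (twoDisks m R) +
          ∫ x in twoDisks m R, ∫ y in twoDisks m R, Real.log (1 / ‖x - y‖))
        Filter.atTop Filter.atBot := by
  obtain ⟨h1, h2⟩ := statement16_aux m hm
  refine ⟨fun c => ?_, h1⟩
  obtain ⟨R, ⟨hR1, hR2⟩, hR3⟩ := (h2.and (h1.eventually (Filter.eventually_lt_atBot c))).exists
  exact ⟨twoDisks m R, hR1, hR2, hR3⟩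
end

section
/- Let n ≥ 5, let α ∈ [2, n−3], and let E ⊂ ℝⁿ be a set of finite perimeter with |E| = |B_1|. Set f_E = χ_{B_1} − χ_E, φ_β(r) = (1/H^{n−1}(∂B_r)) ∫_{∂B_r} I_β f_E dH^{n−1}, and Φ_α(r) = (1/|B_r|) ∫_{B_r} I_α f_E dx. If φ_α is nonincreasing on (0,∞), then for every s > 0 the spherical average φ_{α+2} is differentiable at s with φ_{α+2}'(s) = −(s/n) Φ_α(s). -/
open MeasureTheory Metric Set

theorem aux_ball_const {F : Type*} [NormedAddCommGroup F] [InnerProductSpace ℝ F]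
    [MeasurableSpace F] [BorelSpace F] (μ : Measure F)
    (hμ : ∀ L : F ≃ₗᵢ[ℝ] F, μ.map L = μ) (x y : F) (h : ‖x‖ = ‖y‖) (ρ : ℝ) :
    μ (ball x ρ) = μ (ball y ρ) := by
  let L : F ≃ₗᵢ[ℝ] F := (ℝ ∙ (x - y))ᗮ.reflection
  have hL : L x = y := Submodule.reflection_sub h
  rw [← hL]
  conv_rhs => rw [← hμ L]
  rw [Measure.map_apply L.continuous.measurable measurableSet_ball]
  congr 1
  ext z; simp

theorem aux_unique {F : Type*} [NormedAddCommGroup F] [InnerProductSpace ℝ F]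
    [FiniteDimensional ℝ F]
    [MeasurableSpace F] [BorelSpace F] (μ ν : Measure F) [IsFiniteMeasure μ] [IsFiniteMeasure ν]
    (hμ : ∀ L : F ≃ₗᵢ[ℝ] F, μ.map L = μ) (hν : ∀ L : F ≃ₗᵢ[ℝ] F, ν.map L = ν) (r : ℝ)
    (hμr : ∀ᵐ x ∂μ, x ∈ sphere (0 : F) r) (hνr : ∀ᵐ x ∂ν, x ∈ sphere (0 : F) r) :
    (ν univ).toNNReal • μ = (μ univ).toNNReal • ν := by
  haveI : ProperSpace F := FiniteDimensional.proper ℝ F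
  by_cases hν0 : ν = 0
  · simp [hν0]
  obtain ⟨x0, hx0⟩ : ∃ x0, x0 ∈ sphere (0 : F) r := by
    haveI : (ae ν).NeBot := ae_neBot.2 hν0
    exact hνr.exists
  apply ext_of_forall_integral_eq_of_IsFiniteMeasure
  intro g
  rw [integral_smul_nnreal_measure, integral_smul_nnreal_measure]
  change ν.real univ * _ = μ.real univ * _
  set N := ν.real univ with hN
  set M := μ.real univ with hM
  have hNM : 0 ≤ N * M := by positivity
  have key : ∀ ε > 0, |N * ∫ x, g x ∂μ - M * ∫ x, g x ∂ν| ≤ ε * (N * M) := by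
    intro ε hε
    have hcomp : IsCompact (sphere (0 : F) r) := isCompact_sphere _ _
    have huc := hcomp.uniformContinuousOn_of_continuous g.continuous.continuousOn
    rw [Metric.uniformContinuousOn_iff] at huc
    obtain ⟨ρ, hρ, huc⟩ := huc ε hε
    set k := ν.real (ball x0 ρ) with hk
    set h := μ.real (ball x0 ρ) with hh
    have hkx : ∀ x ∈ sphere (0 : F) r, ν.real (ball x ρ) = k := by
      intro x hx
      rw [hk, measureReal_def, measureReal_def, aux_ball_const ν hν x x0]
      simp at hx hx0; rw [hx, hx0]
    have hhx : ∀ x ∈ sphere (0 : F) r, μ.real (ball x ρ) = h := by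
      intro x hx
      rw [hh, measureReal_def, measureReal_def, aux_ball_const μ hμ x x0]
      simp at hx hx0; rw [hx, hx0]
    have hkpos : 0 < k := by
      by_contra hcon
      have hk0 : k = 0 := le_antisymm (not_lt.1 hcon) measureReal_nonneg
      apply hν0
      have h1 : ν (sphere (0 : F) r) = 0 := by
        apply measure_null_of_locally_null
        intro x hx
        refine ⟨ball x ρ, mem_nhdsWithin_of_mem_nhds (ball_mem_nhds x hρ), ?_⟩
        have := hkx x hx
        rw [hk0, measureReal_eq_zero_iff] at this
        exact this
      have h2 : ν (sphere (0 : F) r)ᶜ = 0 := hνr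
      rw [← Measure.measure_univ_eq_zero, ← union_compl_self (sphere (0 : F) r)]
      exact measure_union_null h1 h2
    let D : Set (F × F) := {p | dist p.1 p.2 < ρ}
    have hD : MeasurableSet D := (isOpen_lt (by fun_prop) (by fun_prop)).measurableSet
    have hi1 : Integrable (D.indicator fun p : F × F => g p.1) (μ.prod ν) := by
      apply Integrable.indicator _ hD
      apply Integrable.of_bound (C := ‖g‖) (by fun_prop)
      exact Filter.Eventually.of_forall fun p => g.norm_coe_le_norm _
    have hi2 : Integrable (D.indicator fun p : F × F => g p.2) (μ.prod ν) := by
      apply Integrable.indicator _ hD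
      apply Integrable.of_bound (C := ‖g‖) (by fun_prop)
      exact Filter.Eventually.of_forall fun p => g.norm_coe_le_norm _
    have hi3 : Integrable (D.indicator fun p : F × F => (1:ℝ)) (μ.prod ν) :=
      (integrable_const _).indicator hD
    have sec1 : ∀ x, ∀ c : ℝ, ∀ (κ : Measure F), ∫ y, (ball x ρ).indicator (fun _ => c) y ∂κ = κ.real (ball x ρ) * c := by
      intro x c κ
      rw [integral_indicator measurableSet_ball, setIntegral_const, smul_eq_mul]
    have e1 : ∫ p, (D.indicator fun p : F × F => g p.1) p ∂(μ.prod ν) = k * ∫ x, g x ∂μ := by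
      rw [integral_prod _ hi1, ← integral_const_mul]
      apply integral_congr_ae
      filter_upwards [hμr] with x hx
      rw [← hkx x hx, ← sec1]
      congr 1; ext y; simp [indicator, D, dist_comm]
    have e3 : ∫ p, (D.indicator fun p : F × F => (1:ℝ)) p ∂(μ.prod ν) = k * M := by
      rw [integral_prod _ hi3, hM]
      have : ∫ x, k ∂μ = k * μ.real univ := by rw [integral_const, smul_eq_mul, mul_comm]
      rw [← this]
      apply integral_congr_ae
      filter_upwards [hμr] with x hx
      rw [← hkx x hx, ← mul_one (ν.real _), ← sec1]
      congr 1; ext y; simp [indicator, D, dist_comm]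
    have e2 : ∫ p, (D.indicator fun p : F × F => g p.2) p ∂(μ.prod ν) = h * ∫ x, g x ∂ν := by
      rw [integral_prod_symm _ hi2, ← integral_const_mul]
      apply integral_congr_ae
      filter_upwards [hνr] with x hx
      rw [← hhx x hx, ← sec1]
      congr 1
    have e4 : ∫ p, (D.indicator fun p : F × F => (1:ℝ)) p ∂(μ.prod ν) = h * N := by
      rw [integral_prod_symm _ hi3, hN]
      have : ∫ x, h ∂ν = h * ν.real univ := by rw [integral_const, smul_eq_mul, mul_comm]
      rw [← this]
      apply integral_congr_ae
      filter_upwards [hνr] with x hx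
      rw [← hhx x hx, ← mul_one (μ.real _), ← sec1]
      congr 1
    have e5 : |k * ∫ x, g x ∂μ - h * ∫ x, g x ∂ν| ≤ ε * (k * M) := by
      rw [← e1, ← e2, ← e3, ← integral_sub hi1 hi2, ← integral_const_mul, ← Real.norm_eq_abs]
      apply norm_integral_le_of_norm_le (hi3.const_mul _)
      have a1 : ∀ᵐ p ∂(μ.prod ν), p.1 ∈ sphere (0 : F) r := Measure.quasiMeasurePreserving_fst.ae hμr
      have a2 : ∀ᵐ p ∂(μ.prod ν), p.2 ∈ sphere (0 : F) r := Measure.quasiMeasurePreserving_snd.ae hνr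
      filter_upwards [a1, a2] with p h1 h2
      by_cases hp : p ∈ D
      · simp only [indicator_of_mem hp, mul_one]
        rw [← dist_eq_norm]
        exact (huc _ h1 _ h2 hp).le
      · simp [indicator_of_notMem hp]
    have e6 : k * (N * ∫ x, g x ∂μ - M * ∫ x, g x ∂ν) = N * (k * ∫ x, g x ∂μ - h * ∫ x, g x ∂ν) := by
      linear_combination (- ∫ x, g x ∂ν) * (e3.symm.trans e4)
    have e7 : k * |N * ∫ x, g x ∂μ - M * ∫ x, g x ∂ν| ≤ k * (ε * (N * M)) := by
      rw [← abs_of_pos hkpos, ← abs_mul, e6, abs_mul, abs_of_nonneg (measureReal_nonneg : 0 ≤ N), abs_of_pos hkpos]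
      nlinarith [mul_le_mul_of_nonneg_left e5 (measureReal_nonneg : 0 ≤ N)]
    exact le_of_mul_le_mul_left e7 hkpos
  have : |N * ∫ x, g x ∂μ - M * ∫ x, g x ∂ν| ≤ 0 := by
    apply le_of_forall_pos_le_add
    intro ε hε
    rw [zero_add]
    rcases hNM.eq_or_lt with h0 | h0
    · have := key 1 one_pos
      rw [← h0] at this; linarith
    · have := key (ε / (N * M)) (by positivity)
      rwa [div_mul_cancel₀ _ h0.ne'] at this
  exact sub_eq_zero.1 (abs_nonpos_iff.1 this)
theorem aux_sphere_lt_top (m : ℕ) (r : ℝ) (hr : 0 < r) :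
    μH[(m : ℝ)] (sphere (0 : EuclideanSpace ℝ (Fin (m+1))) r) < ⊤ := by
  let I : Fin (m+1) → ℝ → (Fin m → ℝ) → EuclideanSpace ℝ (Fin (m+1)) :=
    fun i s y => WithLp.toLp 2 (Fin.insertNth (α := fun _ => ℝ) i s y)
  let Φ : Fin (m+1) → ℝ → (Fin m → ℝ) → EuclideanSpace ℝ (Fin (m+1)) :=
    fun i s y => (r * ‖I i s y‖⁻¹) • I i s y
  have hI : ∀ i s, ContDiff ℝ 1 (I i s) := by
    intro i s
    rw [contDiff_euclidean]
    intro j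
    refine Fin.succAboveCases i ?_ (fun k => ?_) j
    · simp [I]; exact contDiff_const
    · simp [I]; fun_prop
  have hI0 : ∀ i s, s ≠ 0 → ∀ y, I i s y ≠ 0 := by
    intro i s hs y h
    apply hs
    have := congrArg (fun v => v i) h
    simpa [I] using this
  have hΦ : ∀ i s, s ≠ 0 → ContDiff ℝ 1 (Φ i s) := by
    intro i s hs
    have h1 : ContDiff ℝ 1 (fun y => ‖I i s y‖) := (hI i s).norm ℝ (hI0 i s hs)
    have h2 : ContDiff ℝ 1 (fun y => ‖I i s y‖⁻¹) := h1.inv (fun y => norm_ne_zero_iff.2 (hI0 i s hs y))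
    exact (contDiff_const.mul h2).smul (hI i s)
  have hfin : ∀ i s, s ≠ 0 → μH[(m : ℝ)] (Φ i s '' Icc (-1) 1) < ⊤ := by
    intro i s hs
    obtain ⟨K, hK⟩ := (hΦ i s hs).contDiffOn.exists_lipschitzOnWith (s := Icc (-1) 1) (by simp) (convex_Icc _ _) isCompact_Icc
    refine (hK.hausdorffMeasure_image_le (Nat.cast_nonneg m)).trans_lt ?_
    have : (μH[(m:ℝ)] : Measure (Fin m → ℝ)) = volume := by
      have := @hausdorffMeasure_pi_real (Fin m) _
      simpa using this
    rw [this]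
    apply ENNReal.mul_lt_top
    · apply ENNReal.rpow_lt_top_of_nonneg (Nat.cast_nonneg m) (by simp)
    · exact isCompact_Icc.measure_lt_top
  have hsub : sphere (0 : EuclideanSpace ℝ (Fin (m+1))) r ⊆
      ⋃ i : Fin (m+1), (Φ i 1 '' Icc (-1) 1 ∪ Φ i (-1) '' Icc (-1) 1) := by
    intro x hx
    have hx' : ‖x‖ = r := by simpa using hx
    obtain ⟨i, -, hi⟩ := Finset.exists_max_image Finset.univ (fun i => |x i|) ⟨0, Finset.mem_univ _⟩
    have hpos : x i ≠ 0 := by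
      intro h0
      have : x = 0 := by
        ext j
        have := hi j (Finset.mem_univ _)
        simp [h0] at this
        simpa using this
      rw [this] at hx'; simp at hx'; linarith
    have hrec : ∀ s : ℝ, ∀ M : ℝ, 0 < M → x i = s * M → Φ i s (fun j => M⁻¹ * x (i.succAbove j)) = x := by
      intro s M hM hs
      have : I i s (fun j => M⁻¹ * x (i.succAbove j)) = M⁻¹ • x := by
        ext j
        refine Fin.succAboveCases i ?_ (fun k => ?_) j
        · simp [I, hs]; field_simp
        · simp [I]
      simp only [Φ, this, norm_smul, smul_smul, hx', norm_inv, Real.norm_eq_abs, abs_of_pos hM]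
      have : r * (M⁻¹ * r)⁻¹ * M⁻¹ = 1 := by field_simp
      rw [this, one_smul]
    have hbd : (fun j => |x i|⁻¹ * x (i.succAbove j)) ∈ Icc (-1 : Fin m → ℝ) 1 := by
      have hp := abs_pos.2 hpos
      have : ∀ j, |(|x i|⁻¹ * x (i.succAbove j))| ≤ 1 := by
        intro j
        rw [abs_mul, abs_inv, abs_abs, inv_mul_le_one₀ hp]
        exact hi _ (Finset.mem_univ _)
      exact ⟨fun j => (abs_le.1 (this j)).1, fun j => (abs_le.1 (this j)).2⟩
    rw [mem_iUnion]
    refine ⟨i, ?_⟩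
    rcases lt_or_gt_of_ne hpos with h | h
    · right
      exact ⟨_, hbd, hrec _ _ (abs_pos.2 hpos) (by rw [abs_of_neg h]; ring)⟩
    · left
      exact ⟨_, hbd, hrec _ _ (abs_pos.2 hpos) (by rw [abs_of_pos h]; ring)⟩
  refine (measure_mono hsub).trans_lt ?_
  refine (measure_iUnion_fintype_le _ _).trans_lt ?_
  refine ENNReal.sum_lt_top.2 fun i _ => ?_
  exact (measure_union_le _ _).trans_lt (ENNReal.add_lt_top.2 ⟨hfin i 1 (by norm_num), hfin i (-1) (by norm_num)⟩)

theorem aux_sphere_pos (m : ℕ) (r : ℝ) (hr : 0 < r) :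
    μH[(m : ℝ)] (sphere (0 : EuclideanSpace ℝ (Fin (m+1))) r) ≠ 0 := by
  let p : EuclideanSpace ℝ (Fin (m+1)) → (Fin m → ℝ) := fun x j => x j.succ
  have hp : LipschitzWith 1 p := by
    apply LipschitzWith.of_dist_le_mul
    intro x y
    rw [NNReal.coe_one, one_mul, dist_pi_le_iff dist_nonneg]
    intro j
    rw [dist_eq_norm, dist_eq_norm]
    exact PiLp.norm_apply_le (x - y) j.succ
  have h1 := hp.hausdorffMeasure_image_le (d := m) (Nat.cast_nonneg m) (sphere 0 r)
  have hv : (μH[(m:ℝ)] : Measure (Fin m → ℝ)) = volume := by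
    have := @hausdorffMeasure_pi_real (Fin m) _
    simpa using this
  intro h0
  rw [h0, mul_zero, hv] at h1
  have hsub : ball (0 : Fin m → ℝ) (r / (m + 1)) ⊆ p '' sphere 0 r := by
    intro y hy
    have hm : (0:ℝ) < m + 1 := by positivity
    have hy' : ∀ j, |y j| < r / (m+1) := by
      intro j
      rw [mem_ball_zero_iff] at hy
      exact (norm_le_pi_norm y j).trans_lt hy
    have hs : ∑ j, y j ^ 2 ≤ r ^ 2 := by
      calc ∑ j, y j ^ 2 ≤ ∑ j : Fin m, (r / (m+1)) ^ 2 := by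
            apply Finset.sum_le_sum
            intro j _
            rw [← sq_abs]
            exact pow_le_pow_left₀ (abs_nonneg _) (hy' j).le 2
        _ = m * (r / (m+1)) ^ 2 := by simp
        _ ≤ r ^ 2 := by
            rw [div_pow, mul_div_assoc', div_le_iff₀ (by positivity)]
            have : (m : ℝ) ≤ (m+1)^2 := by nlinarith [(Nat.cast_nonneg m : (0:ℝ) ≤ m)]
            nlinarith [sq_nonneg r]
    refine ⟨WithLp.toLp 2 (Fin.cons (Real.sqrt (r ^ 2 - ∑ j, y j ^ 2)) y), ?_, ?_⟩
    · rw [mem_sphere_zero_iff_norm, EuclideanSpace.norm_eq, Fin.sum_univ_succ]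
      simp only [Fin.cons_zero, Fin.cons_succ, Real.norm_eq_abs, sq_abs]
      rw [Real.sq_sqrt (by linarith), sub_add_cancel, Real.sqrt_sq hr.le]
    · ext j; simp [p]
  have h2 : 0 < volume (ball (0 : Fin m → ℝ) (r / (m + 1))) := measure_ball_pos _ _ (by positivity)
  exact absurd (h2.trans_le (measure_mono hsub)) (not_lt.2 h1)

open scoped Pointwise in
theorem aux_toSphere_inv (n : ℕ) (r : ℝ) (L : EuclideanSpace ℝ (Fin n) ≃ₗᵢ[ℝ] EuclideanSpace ℝ (Fin n)) :
    (((volume : Measure (EuclideanSpace ℝ (Fin n))).toSphere.map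
      (fun ω : sphere (0 : EuclideanSpace ℝ (Fin n)) 1 => r • (ω : EuclideanSpace ℝ (Fin n))))).map L =
    ((volume : Measure (EuclideanSpace ℝ (Fin n))).toSphere.map
      (fun ω : sphere (0 : EuclideanSpace ℝ (Fin n)) 1 => r • (ω : EuclideanSpace ℝ (Fin n)))) := by
  have hc : Measurable (fun ω : sphere (0 : EuclideanSpace ℝ (Fin n)) 1 => r • (ω : EuclideanSpace ℝ (Fin n))) := by
    fun_prop
  have hL : Measurable L := L.continuous.measurable
  ext A hA
  rw [Measure.map_apply hL hA, Measure.map_apply hc (hL hA), Measure.map_apply hc hA,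
    Measure.toSphere_apply' _ (hc (hL hA)), Measure.toSphere_apply' _ (hc hA)]
  congr 1
  have hpre : ∀ S : Set (EuclideanSpace ℝ (Fin n)), volume S = volume (L ⁻¹' S) := fun S =>
    (L.measurePreserving.measure_preimage_equiv (f := L.toMeasurableEquiv) S).symm
  conv_rhs => rw [hpre]
  congr 1
  ext x
  simp only [mem_smul, mem_preimage, mem_image]
  constructor
  · rintro ⟨t, ht, y, ⟨ω, hω, rfl⟩, rfl⟩
    refine ⟨t, ht, L ω, ⟨⟨L ω, by simp⟩, ?_, rfl⟩, ?_⟩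
    · simpa using hω
    · simp
  · rintro ⟨t, ht, y, ⟨ω, hω, rfl⟩, h⟩
    refine ⟨t, ht, L.symm ω, ⟨⟨L.symm ω, by simp⟩, ?_, rfl⟩, ?_⟩
    · simpa using hω
    · rw [← map_smul, h]; exact L.symm_apply_apply x

theorem aux_sphAvg (n : ℕ) (hn : 1 ≤ n) (r : ℝ) (hr : 0 < r) (g : EuclideanSpace ℝ (Fin n) → ℝ)
    (hg : StronglyMeasurable g) :
    sphAvg g r = ((n : ℝ) * (volume : Measure (EuclideanSpace ℝ (Fin n))).real (ball 0 1))⁻¹ *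
      ∫ ω : sphere (0 : EuclideanSpace ℝ (Fin n)) 1, g (r • (ω : EuclideanSpace ℝ (Fin n)))
        ∂(volume : Measure (EuclideanSpace ℝ (Fin n))).toSphere := by
  obtain ⟨m, rfl⟩ : ∃ m, n = m + 1 := ⟨n - 1, by omega⟩
  have hm : ((m + 1 : ℕ) : ℝ) - 1 = (m : ℝ) := by push_cast; ring
  unfold sphAvg
  rw [hm]
  set μ := (μH[(m:ℝ)] : Measure (EuclideanSpace ℝ (Fin (m+1)))).restrict (sphere 0 r) with hμ
  set c := (fun ω : sphere (0 : EuclideanSpace ℝ (Fin (m+1))) 1 => r • (ω : EuclideanSpace ℝ (Fin (m+1)))) with hcdef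
  have hc : Measurable c := by fun_prop
  set σ := (volume : Measure (EuclideanSpace ℝ (Fin (m+1)))).toSphere with hσ
  set ν := σ.map c with hν
  have hfin : μ univ < ⊤ := by
    rw [hμ, Measure.restrict_apply_univ]; exact aux_sphere_lt_top m r hr
  have hpos : μ univ ≠ 0 := by
    rw [hμ, Measure.restrict_apply_univ]; exact aux_sphere_pos m r hr
  have : IsFiniteMeasure μ := ⟨hfin⟩
  have hsph : MeasurableSet (sphere (0 : EuclideanSpace ℝ (Fin (m+1))) r) := isClosed_sphere.measurableSet
  have hinv : ∀ L : EuclideanSpace ℝ (Fin (m+1)) ≃ₗᵢ[ℝ] EuclideanSpace ℝ (Fin (m+1)), μ.map L = μ := by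
    intro L
    have h1 := (L.toIsometryEquiv.measurePreserving_hausdorffMeasure (m:ℝ)).restrict_preimage hsph
    have h2 : L.toIsometryEquiv ⁻¹' (sphere 0 r) = sphere (0 : EuclideanSpace ℝ (Fin (m+1))) r := by
      ext x; simp
    rw [h2] at h1
    exact h1.map_eq
  have hu := aux_unique μ ν hinv (aux_toSphere_inv (m+1) r) r (ae_restrict_mem hsph) (by
    refine (ae_map_iff hc.aemeasurable hsph).2 ?_
    apply Filter.Eventually.of_forall
    intro ω
    simp [c, norm_smul, abs_of_pos hr])
  have hνu : ν.real univ = ((m + 1 : ℕ) : ℝ) * (volume : Measure (EuclideanSpace ℝ (Fin (m+1)))).real (ball 0 1) := by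
    rw [measureReal_def, hν, Measure.map_apply hc MeasurableSet.univ, preimage_univ, ← measureReal_def, hσ,
      Measure.toSphere_real_apply_univ, finrank_euclideanSpace_fin]
  have hi := congrArg (fun κ => ∫ x, g x ∂κ) hu
  simp only [integral_smul_nnreal_measure] at hi
  change ν.real univ * _ = μ.real univ * _ at hi
  rw [hν, integral_map hc.aemeasurable hg.aestronglyMeasurable] at hi
  rw [← hν, hνu] at hi
  have hμr : (μH[(m:ℝ)] (sphere (0 : EuclideanSpace ℝ (Fin (m+1))) r)).toReal = μ.real univ := by
    rw [measureReal_def, hμ, Measure.restrict_apply_univ]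
  rw [hμr]
  have h1 : μ.real univ ≠ 0 := by
    rw [measureReal_def]; exact (ENNReal.toReal_pos hpos hfin.ne).ne'
  have h2 : ((m + 1 : ℕ) : ℝ) * (volume : Measure (EuclideanSpace ℝ (Fin (m+1)))).real (ball 0 1) ≠ 0 := by
    apply mul_ne_zero (by positivity)
    rw [measureReal_def]; exact (ENNReal.toReal_pos (measure_ball_pos _ _ one_pos).ne' measure_ball_lt_top.ne).ne'
  rw [inv_mul_eq_iff_eq_mul₀ h1, mul_left_comm, eq_inv_mul_iff_mul_eq₀ h2]
  exact hi

theorem aux_polar (n : ℕ) (hn : 1 ≤ n) (G : EuclideanSpace ℝ (Fin n) → ℝ) (hG : Integrable G) :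
    ∫ x, G x = ∫ ω : sphere (0 : EuclideanSpace ℝ (Fin n)) 1,
      ∫ t in Ioi (0:ℝ), t ^ (n - 1) * G (t • (ω : EuclideanSpace ℝ (Fin n)))
        ∂(volume : Measure ℝ) ∂(volume : Measure (EuclideanSpace ℝ (Fin n))).toSphere := by
  have : Nontrivial (EuclideanSpace ℝ (Fin n)) := by
    have : Nonempty (Fin n) := ⟨⟨0, hn⟩⟩
    infer_instance
  have mp := (volume : Measure (EuclideanSpace ℝ (Fin n))).measurePreserving_homeomorphUnitSphereProd
  have hfr : Module.finrank ℝ (EuclideanSpace ℝ (Fin n)) = n := finrank_euclideanSpace_fin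
  rw [hfr] at mp
  let H : sphere (0:(EuclideanSpace ℝ (Fin n))) 1 × Ioi (0:ℝ) → ℝ := fun p => G ((p.2 : ℝ) • (p.1 : (EuclideanSpace ℝ (Fin n))))
  have hH : ∀ x : ({0}ᶜ : Set (EuclideanSpace ℝ (Fin n))), H (homeomorphUnitSphereProd (EuclideanSpace ℝ (Fin n)) x) = G x := by
    intro x
    simp only [H]
    congr 1
    have : ‖(x:(EuclideanSpace ℝ (Fin n)))‖ ≠ 0 := norm_ne_zero_iff.2 x.2
    simp [smul_smul, this]
  have e1 : ∫ x, G x = ∫ p, H p ∂((volume : Measure (EuclideanSpace ℝ (Fin n))).toSphere.prod (Measure.volumeIoiPow (n-1))) := by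
    rw [← mp.integral_comp (Homeomorph.measurableEmbedding _)]
    simp only [hH]
    rw [integral_subtype_comap (measurableSet_singleton _).compl G, restrict_compl_singleton]
  have i1 : Integrable H ((volume : Measure (EuclideanSpace ℝ (Fin n))).toSphere.prod (Measure.volumeIoiPow (n-1))) := by
    rw [← mp.integrable_comp_emb (Homeomorph.measurableEmbedding _)]
    have : H ∘ (homeomorphUnitSphereProd (EuclideanSpace ℝ (Fin n))) = G ∘ Subtype.val := by ext x; exact hH x
    rw [this, ← integrableOn_iff_comap_subtypeVal (measurableSet_singleton _).compl]
    exact hG.integrableOn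
  rw [e1, integral_prod _ i1]
  congr 1
  ext ω
  simp only [Measure.volumeIoiPow, ENNReal.ofReal, H]
  rw [integral_withDensity_eq_integral_smul, 
    integral_subtype_comap measurableSet_Ioi fun a ↦ Real.toNNReal (a ^ (n - 1)) • G (a • (ω : (EuclideanSpace ℝ (Fin n)))),
    setIntegral_congr_fun measurableSet_Ioi fun x hx ↦ ?_]
  · rw [NNReal.smul_def, Real.coe_toNNReal _ (pow_nonneg (le_of_lt hx) _), smul_eq_mul]
  · exact (measurable_subtype_coe.pow_const _).real_toNNReal

/-- radial weight density -/
noncomputable def kk (n : ℕ) (a b : ℝ) : ℝ → ℝ := (Ioc a b).indicator fun τ => (τ ^ (n - 1))⁻¹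

/-- radial weight -/
noncomputable def PP (n : ℕ) (a b : ℝ) (t : ℝ) : ℝ := ∫ τ in t..b, kk n a b τ

theorem kk_nonneg (n : ℕ) {a b : ℝ} (ha : 0 < a) (t : ℝ) : 0 ≤ kk n a b t := by
  unfold kk
  apply indicator_nonneg
  intro x hx
  have : 0 < x := ha.trans hx.1
  positivity

theorem kk_le (n : ℕ) {a b : ℝ} (ha : 0 < a) (t : ℝ) : ‖kk n a b t‖ ≤ (a ^ (n-1))⁻¹ := by
  rw [Real.norm_of_nonneg (kk_nonneg n ha t)]
  unfold kk
  by_cases h : t ∈ Ioc a b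
  · rw [indicator_of_mem h]
    apply inv_anti₀ (by positivity)
    exact pow_le_pow_left₀ ha.le h.1.le _
  · rw [indicator_of_notMem h]; positivity

theorem kk_meas (n : ℕ) (a b : ℝ) : Measurable (kk n a b) := by
  unfold kk
  exact Measurable.indicator (by fun_prop) measurableSet_Ioc

theorem kk_int (n : ℕ) {a b : ℝ} (ha : 0 < a) : Integrable (kk n a b) := by
  unfold kk
  rw [integrable_indicator_iff measurableSet_Ioc]
  apply Measure.integrableOn_of_bounded (M := (a ^ (n-1))⁻¹) (by simp) (by fun_prop)
  filter_upwards [ae_restrict_mem measurableSet_Ioc] with t ht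
  have := kk_le n ha t (b := b)
  unfold kk at this
  rwa [indicator_of_mem ht] at this

theorem PP_lip (n : ℕ) {a b : ℝ} (ha : 0 < a) : LipschitzWith (Real.toNNReal (a ^ (n-1))⁻¹) (PP n a b) := by
  apply LipschitzWith.of_dist_le_mul
  intro s t
  rw [Real.coe_toNNReal _ (by positivity), Real.dist_eq, Real.dist_eq, abs_sub_comm s t]
  unfold PP
  have : (∫ τ in s..b, kk n a b τ) - ∫ τ in t..b, kk n a b τ = ∫ τ in s..t, kk n a b τ := by
    rw [sub_eq_iff_eq_add, intervalIntegral.integral_add_adjacent_intervals]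
    · exact (kk_int n ha).intervalIntegrable
    · exact (kk_int n ha).intervalIntegrable
  rw [this, ← Real.norm_eq_abs]
  exact intervalIntegral.norm_integral_le_of_norm_le_const fun x _ => kk_le n ha x

theorem PP_zero (n : ℕ) {a b t : ℝ} (h : b ≤ t) : PP n a b t = 0 := by
  unfold PP
  rw [intervalIntegral.integral_symm, neg_eq_zero]
  apply intervalIntegral.integral_zero_ae
  apply Filter.Eventually.of_forall
  intro x hx
  rw [uIoc_of_le h] at hx
  unfold kk
  rw [indicator_of_notMem]
  intro h'; linarith [h'.2, hx.1]

theorem PP_deriv (n : ℕ) {a b t : ℝ} (ha : 0 < a) (hta : t ≠ a) (htb : t ≠ b) :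
    HasDerivAt (PP n a b) (-kk n a b t) t := by
  apply intervalIntegral.integral_hasDerivAt_left (kk_int n ha).intervalIntegrable
  · exact (kk_meas n a b).stronglyMeasurable.stronglyMeasurableAtFilter
  · unfold kk
    rcases lt_or_gt_of_ne hta with h | h
    · have : (Ioc a b).indicator (fun τ => (τ ^ (n - 1))⁻¹) =ᶠ[nhds t] fun _ => (0:ℝ) := by
        filter_upwards [Iio_mem_nhds h] with x hx
        rw [indicator_of_notMem]
        intro h'; exact absurd h'.1 (not_lt.2 (le_of_lt hx))
      exact continuousAt_const.congr this.symm
    · rcases lt_or_gt_of_ne htb with h2 | h2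
      · have : (Ioc a b).indicator (fun τ => (τ ^ (n - 1))⁻¹) =ᶠ[nhds t] fun τ => (τ ^ (n - 1))⁻¹ := by
          filter_upwards [Ioo_mem_nhds h h2] with x hx
          have hx' : x ∈ Ioc a b := ⟨hx.1, hx.2.le⟩
          rw [indicator_of_mem hx']
        refine ContinuousAt.congr ?_ this.symm
        have : t ^ (n-1) ≠ 0 := pow_ne_zero _ (ha.trans h).ne'
        fun_prop (disch := assumption)
      · have : (Ioc a b).indicator (fun τ => (τ ^ (n - 1))⁻¹) =ᶠ[nhds t] fun _ => (0:ℝ) := by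
          filter_upwards [Ioi_mem_nhds h2] with x hx
          rw [indicator_of_notMem]
          intro h'; exact absurd h'.2 (not_le.2 hx)
        exact continuousAt_const.congr this.symm

theorem PP_lineDeriv (n : ℕ) {a b : ℝ} (ha : 0 < a) (x : EuclideanSpace ℝ (Fin n)) (hx : x ≠ 0)
    (hta : ‖x‖ ≠ a) (htb : ‖x‖ ≠ b) (i : Fin n) :
    lineDeriv ℝ (fun x : EuclideanSpace ℝ (Fin n) => PP n a b ‖x‖) x (-EuclideanSpace.single i 1) =
      kk n a b ‖x‖ * (‖x‖⁻¹ * x i) := by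
  have h1 : HasFDerivAt (fun x : EuclideanSpace ℝ (Fin n) => ‖x‖) (fderiv ℝ (fun x : EuclideanSpace ℝ (Fin n) => ‖x‖) x) x :=
    ((contDiffAt_norm ℝ hx (n := 1)).differentiableAt (by simp)).hasFDerivAt
  have h2 : fderiv ℝ (fun x : EuclideanSpace ℝ (Fin n) => ‖x‖) x (EuclideanSpace.single i 1) = ‖x‖⁻¹ * x i := by
    have h3 : HasFDerivAt (fun x : EuclideanSpace ℝ (Fin n) => ‖x‖ ^ 2) _ x := h1.pow 2
    have h4 := (hasStrictFDerivAt_norm_sq x).hasFDerivAt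
    have h5 := congrArg (fun L => L (EuclideanSpace.single i 1)) (h3.unique h4)
    have hx' : ‖x‖ ≠ 0 := norm_ne_zero_iff.2 hx
    simp [EuclideanSpace.inner_single_right] at h5
    field_simp
    linarith
  have h6 := (PP_deriv n ha hta htb).comp_hasFDerivAt x h1
  have h7 := h6.hasLineDerivAt (-EuclideanSpace.single i 1)
  have h8 := h7.lineDeriv
  change lineDeriv ℝ (PP n a b ∘ fun x : EuclideanSpace ℝ (Fin n) => ‖x‖) x _ = _
  rw [h8]
  simp [h2]

theorem aux_div (n : ℕ) (hn : 1 ≤ n) {a b : ℝ} (ha : 0 < a) (hab : a < b)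
    (h : Fin n → EuclideanSpace ℝ (Fin n) → ℝ) (hh : ∀ i, ContDiff ℝ 1 (h i)) :
    ∫ x, PP n a b ‖x‖ * ∑ i, fderiv ℝ (h i) x (EuclideanSpace.single i 1) =
    ∫ ω : sphere (0 : EuclideanSpace ℝ (Fin n)) 1, (∫ t in a..b,
      ∑ i, (ω : EuclideanSpace ℝ (Fin n)) i * h i (t • (ω : EuclideanSpace ℝ (Fin n))))
        ∂(volume : Measure (EuclideanSpace ℝ (Fin n))).toSphere := by
  have hb : 0 < b := ha.trans hab
  have hψl : LipschitzWith (Real.toNNReal (a ^ (n-1))⁻¹ * 1) (fun x : EuclideanSpace ℝ (Fin n) => PP n a b ‖x‖) :=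
    (PP_lip n ha).comp lipschitzWith_one_norm
  have hψc : HasCompactSupport (fun x : EuclideanSpace ℝ (Fin n) => PP n a b ‖x‖) := by
    apply HasCompactSupport.intro (isCompact_closedBall (0 : EuclideanSpace ℝ (Fin n)) b)
    intro x hx
    apply PP_zero
    simp at hx; exact hx.le
  have hae : ∀ᵐ x : EuclideanSpace ℝ (Fin n), x ≠ 0 ∧ ‖x‖ ≠ a ∧ ‖x‖ ≠ b := by
    have s1 : ∀ c : ℝ, 0 < c → ∀ᵐ x : EuclideanSpace ℝ (Fin n), ‖x‖ ≠ c := by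
      intro c hc
      have := Measure.addHaar_sphere_of_ne_zero (volume : Measure (EuclideanSpace ℝ (Fin n))) 0 hc.ne'
      filter_upwards [measure_eq_zero_iff_ae_notMem.1 this] with x hx
      simpa using hx
    have : Nonempty (Fin n) := ⟨⟨0, hn⟩⟩
    have s0 : ∀ᵐ x : EuclideanSpace ℝ (Fin n), x ≠ 0 := by
      have := measure_singleton (μ := (volume : Measure (EuclideanSpace ℝ (Fin n)))) 0
      filter_upwards [measure_eq_zero_iff_ae_notMem.1 this] with x hx
      simpa using hx
    filter_upwards [s0, s1 a ha, s1 b hb] with x h0 h1 h2 using ⟨h0, h1, h2⟩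
  have key : ∀ i, ∫ x, PP n a b ‖x‖ * fderiv ℝ (h i) x (EuclideanSpace.single i 1) =
      ∫ x, kk n a b ‖x‖ * (‖x‖⁻¹ * (x i * h i x)) := by
    intro i
    let χ : ContDiffBump (0 : EuclideanSpace ℝ (Fin n)) := ⟨b + 1, b + 2, by linarith, by linarith⟩
    have hf : ContDiff ℝ 1 (fun x => χ x * h i x) := χ.contDiff.mul (hh i)
    have hfc : HasCompactSupport (fun x => χ x * h i x) := χ.hasCompactSupport.mul_right
    obtain ⟨C, hC⟩ := ContDiff.lipschitzWith_of_hasCompactSupport hfc hf (by simp)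
    have ibp := hC.integral_lineDeriv_mul_eq (μ := volume) hψl hψc (EuclideanSpace.single i 1)
    have e1 : ∀ x, lineDeriv ℝ (fun x => χ x * h i x) x (EuclideanSpace.single i 1) * PP n a b ‖x‖ =
        PP n a b ‖x‖ * fderiv ℝ (h i) x (EuclideanSpace.single i 1) := by
      intro x
      rcases le_or_gt b ‖x‖ with hx | hx
      · rw [PP_zero n hx]; simp
      · have : (fun x => χ x * h i x) =ᶠ[nhds x] h i := by
          have : x ∈ ball (0 : EuclideanSpace ℝ (Fin n)) (b+1) := by simp; linarith
          filter_upwards [isOpen_ball.mem_nhds this] with y hy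
          rw [χ.one_of_mem_closedBall (ball_subset_closedBall hy), one_mul]
        rw [this.lineDeriv_eq, DifferentiableAt.lineDeriv_eq_fderiv, mul_comm]
        exact ((hh i).differentiable (by simp)).differentiableAt
    simp only [e1] at ibp
    rw [ibp]
    apply integral_congr_ae
    filter_upwards [hae] with x hx
    rw [PP_lineDeriv n ha x hx.1 hx.2.1 hx.2.2]
    rcases lt_or_ge b ‖x‖ with hx' | hx'
    · have : kk n a b ‖x‖ = 0 := by
        unfold kk; rw [indicator_of_notMem]; intro h'; linarith [h'.2]
      simp [this]
    · rw [χ.one_of_mem_closedBall (by simp [χ]; linarith)]; ring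
  have i1 : ∀ i, Integrable (fun x => PP n a b ‖x‖ * fderiv ℝ (h i) x (EuclideanSpace.single i 1)) := by
    intro i
    apply Continuous.integrable_of_hasCompactSupport
    · exact hψl.continuous.mul (((hh i).continuous_fderiv (by simp)).clm_apply continuous_const)
    · exact hψc.mul_right
  have i2 : ∀ i, Integrable (fun x : EuclideanSpace ℝ (Fin n) => kk n a b ‖x‖ * (‖x‖⁻¹ * (x i * h i x))) := by
    intro i
    have hcont : Continuous fun x : EuclideanSpace ℝ (Fin n) => x i * h i x := by
      have := (hh i).continuous
      fun_prop
    obtain ⟨C, hC⟩ := (isCompact_closedBall (0 : EuclideanSpace ℝ (Fin n)) b).exists_bound_of_continuousOn hcont.continuousOn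
    have hsupp : (fun x : EuclideanSpace ℝ (Fin n) => kk n a b ‖x‖ * (‖x‖⁻¹ * (x i * h i x))) =
        (closedBall (0 : EuclideanSpace ℝ (Fin n)) b).indicator (fun x : EuclideanSpace ℝ (Fin n) => kk n a b ‖x‖ * (‖x‖⁻¹ * (x i * h i x))) := by
      symm
      rw [indicator_eq_self]
      intro x hx
      by_contra hcon
      apply hx
      have : kk n a b ‖x‖ = 0 := by
        unfold kk; rw [indicator_of_notMem]; intro h'; apply hcon; simpa using h'.2
      simp [this]
    rw [hsupp, integrable_indicator_iff isClosed_closedBall.measurableSet]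
    apply Measure.integrableOn_of_bounded (M := (a^(n-1))⁻¹ * (a⁻¹ * C))
    · exact (isCompact_closedBall _ _).measure_lt_top.ne
    · apply Measurable.aestronglyMeasurable
      exact ((kk_meas n a b).comp measurable_norm).mul (measurable_norm.inv.mul hcont.measurable)
    · filter_upwards [ae_restrict_mem isClosed_closedBall.measurableSet] with x hx
      have hC0 := (norm_nonneg _).trans (hC x hx)
      rcases le_or_gt ‖x‖ a with h1 | h1
      · have : kk n a b ‖x‖ = 0 := by
          unfold kk; rw [indicator_of_notMem]; intro h'; linarith [h'.1]
        rw [this, zero_mul, norm_zero]; positivity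
      · rw [norm_mul, norm_mul]
        gcongr
        · exact kk_le n ha _
        · rw [norm_inv, norm_norm]
          exact inv_anti₀ ha h1.le
        · exact hC x hx
  have e1 : ∫ x, PP n a b ‖x‖ * ∑ i, fderiv ℝ (h i) x (EuclideanSpace.single i 1) =
      ∫ x, ∑ i, kk n a b ‖x‖ * (‖x‖⁻¹ * (x i * h i x)) := by
    simp only [Finset.mul_sum]
    rw [integral_finsetSum _ fun i _ => i1 i, integral_finsetSum _ fun i _ => i2 i]
    exact Finset.sum_congr rfl fun i _ => key i
  rw [e1, aux_polar n hn _ (integrable_finsetSum _ fun i _ => i2 i)]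
  congr 1
  ext ω
  have hω : ‖(ω : EuclideanSpace ℝ (Fin n))‖ = 1 := by simp
  rw [intervalIntegral.integral_of_le hab.le, ← integral_indicator measurableSet_Ioc,
    ← integral_indicator measurableSet_Ioi]
  congr 1
  ext t
  by_cases ht : t ∈ Ioc a b
  · have ht0 : 0 < t := ha.trans ht.1
    have ht' : t ∈ Ioi (0:ℝ) := ht0
    rw [indicator_of_mem ht, indicator_of_mem ht', Finset.mul_sum]
    apply Finset.sum_congr rfl
    intro i _
    rw [norm_smul, hω, mul_one, Real.norm_of_nonneg ht0.le]
    unfold kk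
    rw [indicator_of_mem ht]
    simp only [PiLp.smul_apply, smul_eq_mul]
    field_simp
  · rw [indicator_of_notMem ht]
    by_cases ht' : t ∈ Ioi (0:ℝ)
    · rw [indicator_of_mem ht']
      have ht0 : 0 < t := ht'
      rw [norm_smul, hω, mul_one, Real.norm_of_nonneg ht0.le]
      unfold kk
      rw [indicator_of_notMem ht]
      simp
    · rw [indicator_of_notMem ht']

/-- regularized kernel -/
noncomputable def GG (n : ℕ) (γ ε : ℝ) (y : EuclideanSpace ℝ (Fin n)) : ℝ := (‖y‖ ^ 2 + ε) ^ (γ / 2)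

/-- Laplacian of the regularized kernel -/
noncomputable def DD (n : ℕ) (γ ε : ℝ) (y : EuclideanSpace ℝ (Fin n)) : ℝ :=
  γ * (n * (‖y‖ ^ 2 + ε) ^ (γ / 2 - 1) + (γ - 2) * ((‖y‖ ^ 2 + ε) ^ (γ / 2 - 2) * ‖y‖ ^ 2))

theorem GG_cont (n : ℕ) (γ : ℝ) {ε : ℝ} (hε : 0 < ε) : Continuous (GG n γ ε) := by
  unfold GG
  apply Continuous.rpow_const (by fun_prop)
  intro x; left; positivity

theorem DD_cont (n : ℕ) (γ : ℝ) {ε : ℝ} (hε : 0 < ε) : Continuous (DD n γ ε) := by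
  unfold DD
  have h : ∀ c : ℝ, Continuous fun y : EuclideanSpace ℝ (Fin n) => (‖y‖ ^ 2 + ε) ^ c := by
    intro c
    apply Continuous.rpow_const (by fun_prop)
    intro x; left; positivity
  have h1 := h (γ / 2 - 1)
  have h2 := h (γ / 2 - 2)
  fun_prop

theorem GG_ident (n : ℕ) (hn : 1 ≤ n) (γ : ℝ) {ε : ℝ} (hε : 0 < ε) {a b : ℝ} (ha : 0 < a) (hab : a < b)
    (ξ : EuclideanSpace ℝ (Fin n)) :
    ∫ x, PP n a b ‖x‖ * DD n γ ε (x - ξ) =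
    ∫ ω : sphere (0 : EuclideanSpace ℝ (Fin n)) 1,
      (GG n γ ε (b • (ω : EuclideanSpace ℝ (Fin n)) - ξ) - GG n γ ε (a • (ω : EuclideanSpace ℝ (Fin n)) - ξ))
        ∂(volume : Measure (EuclideanSpace ℝ (Fin n))).toSphere := by
  let h : Fin n → EuclideanSpace ℝ (Fin n) → ℝ := fun i x =>
    γ * ((‖x - ξ‖ ^ 2 + ε) ^ (γ / 2 - 1) * (x - ξ) i)
  have hpos : ∀ x : EuclideanSpace ℝ (Fin n), ‖x - ξ‖ ^ 2 + ε ≠ 0 := fun x => by positivity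
  have hq : ContDiff ℝ 1 fun x : EuclideanSpace ℝ (Fin n) => ‖x - ξ‖ ^ 2 + ε :=
    ((contDiff_id.sub contDiff_const).norm_sq ℝ).add contDiff_const
  have hc : ∀ i, ContDiff ℝ 1 fun x : EuclideanSpace ℝ (Fin n) => (x - ξ) i := by
    intro i
    have : ContDiff ℝ 1 fun x : EuclideanSpace ℝ (Fin n) => x i - ξ i := by fun_prop
    exact this
  have hh : ∀ i, ContDiff ℝ 1 (h i) := fun i =>
    contDiff_const.mul ((hq.rpow_const_of_ne hpos).mul (hc i))
  have key := aux_div n hn ha hab h hh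
  have e1 : ∀ x, ∑ i, fderiv ℝ (h i) x (EuclideanSpace.single i 1) = DD n γ ε (x - ξ) := by
    intro x
    have hqd : HasFDerivAt (fun x : EuclideanSpace ℝ (Fin n) => ‖x - ξ‖ ^ 2 + ε)
        (2 • (innerSL ℝ (x - ξ))) x := by
      have := (hasStrictFDerivAt_norm_sq (x - ξ)).hasFDerivAt.comp x ((hasFDerivAt_id x).sub_const ξ)
      have := this.add_const ε
      simpa using this
    have e2 : ∀ i, fderiv ℝ (h i) x (EuclideanSpace.single i 1) =
        γ * ((‖x - ξ‖ ^ 2 + ε) ^ (γ / 2 - 1) + (γ - 2) * ((‖x - ξ‖ ^ 2 + ε) ^ (γ / 2 - 2) * ((x - ξ) i) ^ 2)) := by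
      intro i
      have hcd : HasFDerivAt (fun x : EuclideanSpace ℝ (Fin n) => (x - ξ) i) (EuclideanSpace.proj i : EuclideanSpace ℝ (Fin n) →L[ℝ] ℝ) x := by
        have := (EuclideanSpace.proj i : EuclideanSpace ℝ (Fin n) →L[ℝ] ℝ).hasFDerivAt.comp x ((hasFDerivAt_id x).sub_const ξ)
        rw [ContinuousLinearMap.comp_id] at this
        exact this
      have hp := (hqd.rpow_const (p := γ / 2 - 1) (Or.inl (hpos x))).mul hcd
      have hp2 := (hp.const_mul γ).fderiv
      have : fderiv ℝ (h i) x = _ := hp2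
      rw [this]
      have h2 : γ / 2 - 1 - 1 = γ / 2 - 2 := by ring
      simp [EuclideanSpace.inner_single_right, h2]
      ring
    rw [Finset.sum_congr rfl fun i _ => e2 i, DD, ← Finset.mul_sum, Finset.sum_add_distrib, ← Finset.mul_sum,
      ← Finset.mul_sum, EuclideanSpace.norm_sq_eq]
    simp
  simp only [e1] at key
  rw [key]
  congr 1
  ext ω
  have hd : ∀ t : ℝ, HasDerivAt (fun t : ℝ => GG n γ ε (t • (ω : EuclideanSpace ℝ (Fin n)) - ξ))
      (∑ i, (ω : EuclideanSpace ℝ (Fin n)) i * h i (t • (ω : EuclideanSpace ℝ (Fin n)))) t := by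
    intro t
    have h1 : HasDerivAt (fun t : ℝ => t • (ω : EuclideanSpace ℝ (Fin n)) - ξ) (ω : EuclideanSpace ℝ (Fin n)) t := by
      simpa using ((hasDerivAt_id t).smul_const (ω : EuclideanSpace ℝ (Fin n))).sub_const ξ
    have h2 := (h1.norm_sq.add_const ε).rpow_const (p := γ / 2) (Or.inl (hpos (t • (ω : EuclideanSpace ℝ (Fin n)))))
    unfold GG
    convert h2 using 1
    rw [PiLp.inner_apply]
    simp only [h, Finset.mul_sum, Finset.sum_mul]
    apply Finset.sum_congr rfl
    intro i _
    simp
    ring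
  rw [intervalIntegral.integral_eq_sub_of_hasDerivAt (fun t _ => hd t)]
  apply Continuous.intervalIntegrable
  apply continuous_finsetSum
  intro i _
  exact continuous_const.mul ((hh i).continuous.comp (by fun_prop))

theorem GG_bdd (n : ℕ) {γ ε : ℝ} (hγ : γ ≤ 0) (hε : 0 < ε) (y : EuclideanSpace ℝ (Fin n)) :
    ‖GG n γ ε y‖ ≤ ε ^ (γ / 2) := by
  unfold GG
  rw [Real.norm_of_nonneg (by positivity)]
  apply Real.rpow_le_rpow_of_nonpos hε (by nlinarith [sq_nonneg ‖y‖]) (by linarith)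

theorem sq_rpow_half (x : ℝ) (hx : 0 ≤ x) (c : ℝ) : (x ^ 2) ^ (c / 2) = x ^ c := by
  rw [← Real.rpow_natCast, ← Real.rpow_mul hx]; congr 1; push_cast; ring

theorem GG_le (n : ℕ) {γ ε : ℝ} (hγ : γ ≤ 0) (hε : 0 < ε) (y : EuclideanSpace ℝ (Fin n)) (hy : y ≠ 0) :
    ‖GG n γ ε y‖ ≤ 1 * ‖y‖ ^ γ := by
  have hy' : 0 < ‖y‖ := norm_pos_iff.2 hy
  unfold GG
  rw [Real.norm_of_nonneg (by positivity), one_mul, ← sq_rpow_half _ hy'.le γ]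
  apply Real.rpow_le_rpow_of_nonpos (by positivity) (by linarith) (by linarith)

theorem DD_le_aux (n : ℕ) {γ ε : ℝ} (hε : 0 < ε) (y : EuclideanSpace ℝ (Fin n)) :
    ‖DD n γ ε y‖ ≤ |γ| * (n + |γ - 2|) * (‖y‖ ^ 2 + ε) ^ (γ / 2 - 1) := by
  unfold DD
  have h1 : (‖y‖ ^ 2 + ε) ^ (γ / 2 - 2) * ‖y‖ ^ 2 ≤ (‖y‖ ^ 2 + ε) ^ (γ / 2 - 1) := by
    have : (‖y‖ ^ 2 + ε) ^ (γ / 2 - 1) = (‖y‖ ^ 2 + ε) ^ (γ / 2 - 2) * (‖y‖ ^ 2 + ε) := by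
      rw [← Real.rpow_add_one (by positivity)]; congr 1; ring
    rw [this]
    gcongr
    linarith
  have h0 : 0 ≤ (‖y‖ ^ 2 + ε) ^ (γ / 2 - 2) * ‖y‖ ^ 2 := by positivity
  have h3 : 0 ≤ (‖y‖ ^ 2 + ε) ^ (γ / 2 - 1) := by positivity
  rw [norm_mul, Real.norm_eq_abs, mul_assoc]
  gcongr
  refine (norm_add_le _ _).trans ?_
  rw [norm_mul, norm_mul, Real.norm_of_nonneg h0, Real.norm_of_nonneg h3, Real.norm_eq_abs, Real.norm_eq_abs,
    Nat.abs_cast, add_mul]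
  gcongr

theorem DD_bdd (n : ℕ) {γ ε : ℝ} (hγ : γ ≤ 0) (hε : 0 < ε) (y : EuclideanSpace ℝ (Fin n)) :
    ‖DD n γ ε y‖ ≤ |γ| * (n + |γ - 2|) * ε ^ (γ / 2 - 1) := by
  refine (DD_le_aux n hε y).trans ?_
  gcongr ?_ * ?_
  apply Real.rpow_le_rpow_of_nonpos hε (by nlinarith [sq_nonneg ‖y‖]) (by linarith)

theorem DD_le (n : ℕ) {γ ε : ℝ} (hγ : γ ≤ 0) (hε : 0 < ε) (y : EuclideanSpace ℝ (Fin n)) (hy : y ≠ 0) :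
    ‖DD n γ ε y‖ ≤ (|γ| * (n + |γ - 2|)) * ‖y‖ ^ (γ - 2) := by
  have hy' : 0 < ‖y‖ := norm_pos_iff.2 hy
  refine (DD_le_aux n hε y).trans ?_
  gcongr ?_ * ?_
  rw [← sq_rpow_half _ hy'.le (γ - 2), show (γ - 2) / 2 = γ / 2 - 1 by ring]
  apply Real.rpow_le_rpow_of_nonpos (by positivity) (by linarith) (by linarith)

open Filter Topology in
theorem q_tendsto (n : ℕ) (c : ℝ) (y : EuclideanSpace ℝ (Fin n)) (hy : y ≠ 0) :
    Tendsto (fun ε : ℝ => (‖y‖ ^ 2 + ε) ^ (c / 2)) (𝓝[>] 0) (𝓝 (‖y‖ ^ c)) := by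
  have hy' : 0 < ‖y‖ := norm_pos_iff.2 hy
  rw [← sq_rpow_half _ hy'.le c]
  have h1 : ContinuousAt (fun ε : ℝ => (‖y‖ ^ 2 + ε) ^ (c / 2)) 0 := by
    apply ContinuousAt.rpow_const (by fun_prop)
    left; simpa using hy
  have := h1.tendsto
  simp only [add_zero] at this
  exact this.mono_left nhdsWithin_le_nhds

open Filter Topology in
theorem GG_tendsto (n : ℕ) (γ : ℝ) (y : EuclideanSpace ℝ (Fin n)) (hy : y ≠ 0) :
    Tendsto (fun ε : ℝ => GG n γ ε y) (𝓝[>] 0) (𝓝 (‖y‖ ^ γ)) := q_tendsto n γ y hy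

open Filter Topology in
theorem DD_tendsto (n : ℕ) (γ : ℝ) (y : EuclideanSpace ℝ (Fin n)) (hy : y ≠ 0) :
    Tendsto (fun ε : ℝ => DD n γ ε y) (𝓝[>] 0) (𝓝 (γ * (n + γ - 2) * ‖y‖ ^ (γ - 2))) := by
  have hy' : 0 < ‖y‖ := norm_pos_iff.2 hy
  have h1 := q_tendsto n (γ - 2) y hy
  have h2 := q_tendsto n (γ - 4) y hy
  rw [show (γ - 2) / 2 = γ / 2 - 1 by ring] at h1
  rw [show (γ - 4) / 2 = γ / 2 - 2 by ring] at h2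
  have h3 := ((h1.const_mul (n:ℝ)).add ((h2.mul_const (‖y‖ ^ 2)).const_mul (γ - 2))).const_mul γ
  have h4 : ‖y‖ ^ (γ - 2) = ‖y‖ ^ (γ - 4) * ‖y‖ ^ 2 := by
    rw [← Real.rpow_natCast, ← Real.rpow_add hy']; congr 1; push_cast; ring
  unfold DD
  convert h3 using 2
  rw [← h4]; ring

theorem pow_locInt (n : ℕ) (hn : 1 ≤ n) (β : ℝ) (hβ : -(n:ℝ) < β) :
    IntegrableOn (fun y : EuclideanSpace ℝ (Fin n) => ‖y‖ ^ β) (ball 0 1) := by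
  have : Nontrivial (EuclideanSpace ℝ (Fin n)) := by
    have : Nonempty (Fin n) := ⟨⟨0, hn⟩⟩
    infer_instance
  rw [integrableOn_fun_norm_addHaar volume (f := fun t => t ^ β), finrank_euclideanSpace_fin]
  have h1 : IntegrableOn (fun t : ℝ => t ^ ((n:ℝ) - 1 + β)) (Ioo 0 1) := by
    rw [intervalIntegral.integrableOn_Ioo_rpow_iff one_pos]; linarith
  refine h1.congr_fun ?_ measurableSet_Ioo
  intro t ht
  simp only [smul_eq_mul]
  rw [Real.rpow_add ht.1, ← Real.rpow_natCast, Nat.cast_sub hn, Nat.cast_one]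

/-- dominating function -/
noncomputable def dom (n : ℕ) (β : ℝ) (f : EuclideanSpace ℝ (Fin n) → ℝ) (x ξ : EuclideanSpace ℝ (Fin n)) : ℝ :=
  (ball (0 : EuclideanSpace ℝ (Fin n)) 1).indicator (fun y => ‖y‖ ^ β) (x - ξ) + |f ξ|

theorem dom_int (n : ℕ) (hn : 1 ≤ n) (β : ℝ) (hβ : -(n:ℝ) < β) (f : EuclideanSpace ℝ (Fin n) → ℝ)
    (hf : Integrable f) (x : EuclideanSpace ℝ (Fin n)) : Integrable (dom n β f x) := by
  have h1 := (integrable_indicator_iff measurableSet_ball).2 (pow_locInt n hn β hβ)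
  exact (h1.comp_sub_left x).add hf.abs

theorem dom_integral (n : ℕ) (hn : 1 ≤ n) (β : ℝ) (hβ : -(n:ℝ) < β) (f : EuclideanSpace ℝ (Fin n) → ℝ)
    (hf : Integrable f) (x : EuclideanSpace ℝ (Fin n)) : ∫ ξ, dom n β f x ξ = ∫ ξ, dom n β f 0 ξ := by
  have h1 := (integrable_indicator_iff measurableSet_ball).2 (pow_locInt n hn β hβ)
  unfold dom
  rw [integral_add (h1.comp_sub_left x) hf.abs, integral_add (h1.comp_sub_left 0) hf.abs]
  rw [integral_sub_left_eq_self, integral_sub_left_eq_self]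

theorem dom_le (n : ℕ) {β : ℝ} (hβ : β ≤ 0) (f : EuclideanSpace ℝ (Fin n) → ℝ) (hf1 : ∀ ξ, |f ξ| ≤ 1)
    (C : ℝ) (hC : 0 ≤ C) (K : EuclideanSpace ℝ (Fin n) → ℝ) (hK : ∀ y ≠ 0, ‖K y‖ ≤ C * ‖y‖ ^ β)
    (x ξ : EuclideanSpace ℝ (Fin n)) (h : ξ ≠ x) : ‖f ξ * K (x - ξ)‖ ≤ C * dom n β f x ξ := by
  have hne : x - ξ ≠ 0 := sub_ne_zero.2 h.symm
  have h1 := hK _ hne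
  rw [norm_mul, Real.norm_eq_abs (f ξ)]
  have h2 : |f ξ| * ‖x - ξ‖ ^ β ≤ dom n β f x ξ := by
    unfold dom
    by_cases hm : x - ξ ∈ ball (0 : EuclideanSpace ℝ (Fin n)) 1
    · rw [indicator_of_mem hm]
      have : 0 ≤ ‖x - ξ‖ ^ β := by positivity
      nlinarith [hf1 ξ, abs_nonneg (f ξ)]
    · rw [indicator_of_notMem hm, zero_add]
      have h3 : 1 ≤ ‖x - ξ‖ := by simpa using hm
      exact mul_le_of_le_one_right (abs_nonneg _) (Real.rpow_le_one_of_one_le_of_nonpos h3 hβ)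
  calc |f ξ| * ‖K (x - ξ)‖ ≤ |f ξ| * (C * ‖x - ξ‖ ^ β) := by gcongr
    _ = C * (|f ξ| * ‖x - ξ‖ ^ β) := by ring
    _ ≤ _ := by gcongr

theorem ae_ne' (n : ℕ) (hn : 1 ≤ n) (x : EuclideanSpace ℝ (Fin n)) : ∀ᵐ ξ : EuclideanSpace ℝ (Fin n), ξ ≠ x := by
  have : Nonempty (Fin n) := ⟨⟨0, hn⟩⟩
  have := measure_singleton (μ := (volume : Measure (EuclideanSpace ℝ (Fin n)))) x
  filter_upwards [measure_eq_zero_iff_ae_notMem.1 this] with x hx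
  simpa using hx

theorem pot_bound (n : ℕ) (hn : 1 ≤ n) {β : ℝ} (hβ0 : -(n:ℝ) < β) (hβ : β ≤ 0) (f : EuclideanSpace ℝ (Fin n) → ℝ)
    (hf : Integrable f) (hf1 : ∀ ξ, |f ξ| ≤ 1)
    (C : ℝ) (hC : 0 ≤ C) (K : EuclideanSpace ℝ (Fin n) → ℝ) (hK : ∀ y ≠ 0, ‖K y‖ ≤ C * ‖y‖ ^ β)
    (x : EuclideanSpace ℝ (Fin n)) : ‖∫ ξ, f ξ * K (x - ξ)‖ ≤ C * ∫ ξ, dom n β f 0 ξ := by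
  rw [← dom_integral n hn β hβ0 f hf x, ← integral_const_mul]
  apply norm_integral_le_of_norm_le ((dom_int n hn β hβ0 f hf x).const_mul C)
  filter_upwards [ae_ne' n hn x] with ξ hξ
  exact dom_le n hβ f hf1 C hC K hK x ξ hξ

open Filter Topology in
theorem pot_tendsto (n : ℕ) (hn : 1 ≤ n) {β : ℝ} (hβ0 : -(n:ℝ) < β) (hβ : β ≤ 0) (f : EuclideanSpace ℝ (Fin n) → ℝ)
    (hf : Integrable f) (hf1 : ∀ ξ, |f ξ| ≤ 1)
    (C : ℝ) (hC : 0 ≤ C) (K : ℝ → EuclideanSpace ℝ (Fin n) → ℝ) (K0 : EuclideanSpace ℝ (Fin n) → ℝ)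
    (hKm : ∀ ε > 0, Continuous (K ε))
    (hK : ∀ ε > 0, ∀ y ≠ 0, ‖K ε y‖ ≤ C * ‖y‖ ^ β)
    (hlim : ∀ y ≠ 0, Tendsto (fun ε => K ε y) (𝓝[>] 0) (𝓝 (K0 y)))
    (x : EuclideanSpace ℝ (Fin n)) :
    Tendsto (fun ε => ∫ ξ, f ξ * K ε (x - ξ)) (𝓝[>] 0) (𝓝 (∫ ξ, f ξ * K0 (x - ξ))) := by
  apply tendsto_integral_filter_of_dominated_convergence (fun ξ => C * dom n β f x ξ)
  · filter_upwards [self_mem_nhdsWithin] with ε hε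
    have := hKm ε hε
    exact hf.aestronglyMeasurable.mul (by fun_prop : Continuous fun ξ => K ε (x - ξ)).aestronglyMeasurable
  · filter_upwards [self_mem_nhdsWithin] with ε hε
    filter_upwards [ae_ne' n hn x] with ξ hξ
    exact dom_le n hβ f hf1 C hC (K ε) (hK ε hε) x ξ hξ
  · exact (dom_int n hn β hβ0 f hf x).const_mul C
  · filter_upwards [ae_ne' n hn x] with ξ hξ
    exact (hlim _ (sub_ne_zero.2 hξ.symm)).const_mul _

theorem pot_meas (n : ℕ) (f K : EuclideanSpace ℝ (Fin n) → ℝ) (hf : Measurable f) (hK : Measurable K) :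
    StronglyMeasurable fun x => ∫ ξ, f ξ * K (x - ξ) := by
  apply StronglyMeasurable.integral_prod_right' (f := fun p : EuclideanSpace ℝ (Fin n) × EuclideanSpace ℝ (Fin n) => f p.2 * K (p.1 - p.2))
  exact ((hf.comp measurable_snd).mul (hK.comp (measurable_fst.sub measurable_snd))).stronglyMeasurable

theorem PPn_int (n : ℕ) {a b : ℝ} (ha : 0 < a) :
    Integrable (fun x : EuclideanSpace ℝ (Fin n) => PP n a b ‖x‖) := by
  apply Continuous.integrable_of_hasCompactSupport
  · exact (PP_lip n ha).continuous.comp continuous_norm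
  · apply HasCompactSupport.intro (isCompact_closedBall (0 : EuclideanSpace ℝ (Fin n)) b)
    intro x hx
    apply PP_zero
    simp at hx; exact hx.le

theorem pot_ident_eps (n : ℕ) (hn : 1 ≤ n) {γ : ℝ} (hγ : γ ≤ 0) {ε : ℝ} (hε : 0 < ε) {a b : ℝ} (ha : 0 < a) (hab : a < b)
    (f : EuclideanSpace ℝ (Fin n) → ℝ) (hf : Integrable f) :
    ∫ x, PP n a b ‖x‖ * ∫ ξ, f ξ * DD n γ ε (x - ξ) =
    ∫ ω : sphere (0 : EuclideanSpace ℝ (Fin n)) 1,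
      ((∫ ξ, f ξ * GG n γ ε (b • (ω : EuclideanSpace ℝ (Fin n)) - ξ)) -
        ∫ ξ, f ξ * GG n γ ε (a • (ω : EuclideanSpace ℝ (Fin n)) - ξ))
        ∂(volume : Measure (EuclideanSpace ℝ (Fin n))).toSphere := by
  have hDc := DD_cont n γ hε
  have hGc := GG_cont n γ hε
  have e1 : ∫ x, PP n a b ‖x‖ * ∫ ξ, f ξ * DD n γ ε (x - ξ) =
      ∫ ξ, f ξ * ∫ x, PP n a b ‖x‖ * DD n γ ε (x - ξ) := by
    simp only [← integral_const_mul]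
    rw [integral_integral_swap]
    · congr 1; ext ξ; congr 1; ext x; ring
    · have h1 := (PPn_int n ha (b := b)).mul_prod hf
      have h2 := h1.bdd_mul (f := fun p : EuclideanSpace ℝ (Fin n) × EuclideanSpace ℝ (Fin n) => DD n γ ε (p.1 - p.2))
        (c := |γ| * (n + |γ - 2|) * ε ^ (γ / 2 - 1))
        (by fun_prop : Continuous _).aestronglyMeasurable (Filter.Eventually.of_forall fun p => DD_bdd n hγ hε _)
      refine h2.congr (Filter.Eventually.of_forall fun p => ?_)
      simp only [Function.uncurry]; ring
  have hGint : ∀ x, Integrable fun ξ => f ξ * GG n γ ε (x - ξ) := by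
    intro x
    refine (hf.bdd_mul (f := fun ξ => GG n γ ε (x - ξ)) (c := ε ^ (γ / 2)) (by fun_prop : Continuous _).aestronglyMeasurable
      (Filter.Eventually.of_forall fun p => GG_bdd n hγ hε _)).congr (Filter.Eventually.of_forall fun p => ?_)
    simp only; ring
  rw [e1]
  simp only [GG_ident n hn γ hε ha hab, ← integral_const_mul]
  rw [integral_integral_swap]
  · congr 1; ext ω
    rw [← integral_sub (hGint _) (hGint _)]
    congr 1; ext ξ; ring
  · have h1 : Integrable (fun p : EuclideanSpace ℝ (Fin n) × sphere (0 : EuclideanSpace ℝ (Fin n)) 1 => f p.1 * (1:ℝ))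
      (volume.prod (volume : Measure (EuclideanSpace ℝ (Fin n))).toSphere) := hf.mul_prod (integrable_const 1)
    have h2 := h1.bdd_mul (f := fun p : EuclideanSpace ℝ (Fin n) × sphere (0 : EuclideanSpace ℝ (Fin n)) 1 =>
      GG n γ ε (b • (p.2 : EuclideanSpace ℝ (Fin n)) - p.1) - GG n γ ε (a • (p.2 : EuclideanSpace ℝ (Fin n)) - p.1))
      (c := ε ^ (γ / 2) + ε ^ (γ / 2)) (by fun_prop : Continuous _).aestronglyMeasurable
      (Filter.Eventually.of_forall fun p => (norm_sub_le _ _).trans (add_le_add (GG_bdd n hγ hε _) (GG_bdd n hγ hε _)))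
    refine h2.congr (Filter.Eventually.of_forall fun p => ?_)
    simp only [Function.uncurry]; ring

open Filter Topology in
theorem pot_ident (n : ℕ) (hn : 1 ≤ n) {γ : ℝ} (hγ : γ ≤ 0) (hγ2 : -(n:ℝ) < γ - 2) {a b : ℝ} (ha : 0 < a) (hab : a < b)
    (f : EuclideanSpace ℝ (Fin n) → ℝ) (hf : Integrable f) (hfm : Measurable f) (hf1 : ∀ ξ, |f ξ| ≤ 1) :
    ∫ x, PP n a b ‖x‖ * ∫ ξ, f ξ * (γ * (n + γ - 2) * ‖x - ξ‖ ^ (γ - 2)) =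
    ∫ ω : sphere (0 : EuclideanSpace ℝ (Fin n)) 1,
      ((∫ ξ, f ξ * ‖b • (ω : EuclideanSpace ℝ (Fin n)) - ξ‖ ^ γ) -
        ∫ ξ, f ξ * ‖a • (ω : EuclideanSpace ℝ (Fin n)) - ξ‖ ^ γ)
        ∂(volume : Measure (EuclideanSpace ℝ (Fin n))).toSphere := by
  have hγ1 : -(n:ℝ) < γ := by linarith
  have L1 : Tendsto (fun ε => ∫ x, PP n a b ‖x‖ * ∫ ξ, f ξ * DD n γ ε (x - ξ)) (𝓝[>] 0)
      (𝓝 (∫ x, PP n a b ‖x‖ * ∫ ξ, f ξ * (γ * (n + γ - 2) * ‖x - ξ‖ ^ (γ - 2)))) := by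
    apply tendsto_integral_filter_of_dominated_convergence
      (fun x => ‖PP n a b ‖x‖‖ * ((|γ| * (n + |γ - 2|)) * ∫ ξ, dom n (γ - 2) f 0 ξ))
    · filter_upwards [self_mem_nhdsWithin] with ε hε
      exact (PPn_int n ha).aestronglyMeasurable.mul
        (pot_meas n f _ hfm (DD_cont n γ hε).measurable).aestronglyMeasurable
    · filter_upwards [self_mem_nhdsWithin] with ε hε
      refine Eventually.of_forall fun x => ?_
      rw [norm_mul]
      gcongr
      exact pot_bound n hn hγ2 (by linarith) f hf hf1 _ (by positivity) _ (fun y hy => DD_le n hγ hε y hy) x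
    · exact (PPn_int n ha).norm.mul_const _
    · refine Eventually.of_forall fun x => ?_
      exact (pot_tendsto n hn hγ2 (by linarith) f hf hf1 (|γ| * (n + |γ - 2|)) (by positivity) (fun ε => DD n γ ε)
        (fun y => γ * (n + γ - 2) * ‖y‖ ^ (γ - 2)) (fun ε hε => DD_cont n γ hε) (fun ε hε y hy => DD_le n hγ hε y hy)
        (fun y hy => DD_tendsto n γ y hy) x).const_mul _
  have L2 : Tendsto (fun ε => ∫ x, PP n a b ‖x‖ * ∫ ξ, f ξ * DD n γ ε (x - ξ)) (𝓝[>] 0)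
      (𝓝 (∫ ω : sphere (0 : EuclideanSpace ℝ (Fin n)) 1,
      ((∫ ξ, f ξ * ‖b • (ω : EuclideanSpace ℝ (Fin n)) - ξ‖ ^ γ) -
        ∫ ξ, f ξ * ‖a • (ω : EuclideanSpace ℝ (Fin n)) - ξ‖ ^ γ)
        ∂(volume : Measure (EuclideanSpace ℝ (Fin n))).toSphere)) := by
    have hev : (fun ε => ∫ x, PP n a b ‖x‖ * ∫ ξ, f ξ * DD n γ ε (x - ξ)) =ᶠ[𝓝[>] 0]
      fun ε => ∫ ω : sphere (0 : EuclideanSpace ℝ (Fin n)) 1,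
      ((∫ ξ, f ξ * GG n γ ε (b • (ω : EuclideanSpace ℝ (Fin n)) - ξ)) -
        ∫ ξ, f ξ * GG n γ ε (a • (ω : EuclideanSpace ℝ (Fin n)) - ξ))
        ∂(volume : Measure (EuclideanSpace ℝ (Fin n))).toSphere := by
      filter_upwards [self_mem_nhdsWithin] with ε hε
      exact pot_ident_eps n hn hγ hε ha hab f hf
    refine Tendsto.congr' hev.symm ?_
    apply tendsto_integral_filter_of_dominated_convergence
      (fun ω => (1 * ∫ ξ, dom n γ f 0 ξ) + (1 * ∫ ξ, dom n γ f 0 ξ))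
    · filter_upwards [self_mem_nhdsWithin] with ε hε
      have hm := (pot_meas n f _ hfm (GG_cont n γ hε).measurable)
      exact ((hm.comp_measurable (by fun_prop)).sub (hm.comp_measurable (by fun_prop))).aestronglyMeasurable
    · filter_upwards [self_mem_nhdsWithin] with ε hε
      refine Eventually.of_forall fun ω => ?_
      refine (norm_sub_le _ _).trans (add_le_add ?_ ?_)
      · exact pot_bound n hn hγ1 hγ f hf hf1 1 zero_le_one _ (fun y hy => GG_le n hγ hε y hy) _
      · exact pot_bound n hn hγ1 hγ f hf hf1 1 zero_le_one _ (fun y hy => GG_le n hγ hε y hy) _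
    · exact integrable_const _
    · refine Eventually.of_forall fun ω => ?_
      have := fun x => (pot_tendsto n hn hγ1 hγ f hf hf1 1 zero_le_one (fun ε => GG n γ ε)
        (fun y => ‖y‖ ^ γ) (fun ε hε => GG_cont n γ hε) (fun ε hε y hy => GG_le n hγ hε y hy)
        (fun y hy => GG_tendsto n γ y hy) x)
      exact (this _).sub (this _)
  exact tendsto_nhds_unique L1 L2

theorem PP_eq (n : ℕ) {a b : ℝ} (x : EuclideanSpace ℝ (Fin n)) :
    PP n a b ‖x‖ = ∫ τ, (ball (0 : EuclideanSpace ℝ (Fin n)) τ).indicator (fun _ => kk n a b τ) x := by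
  rcases le_or_gt ‖x‖ b with h | h
  · unfold PP
    rw [intervalIntegral.integral_of_le h, ← integral_indicator measurableSet_Ioc]
    congr 1; ext τ
    by_cases h1 : ‖x‖ < τ
    · by_cases h2 : τ ≤ b
      · simp [indicator, h1, h2]
      · simp [indicator, h2, kk]
    · simp [indicator, h1]
  · rw [PP_zero n h.le]
    symm
    rw [integral_eq_zero_of_ae]
    refine Filter.Eventually.of_forall fun τ => ?_
    by_cases h1 : ‖x‖ < τ
    · have : ¬ τ ≤ b := by linarith
      simp [indicator, this, kk]
    · simp [indicator, h1]

theorem PP_fubini (n : ℕ) {a b : ℝ} (ha : 0 < a) (hab : a < b) (W : EuclideanSpace ℝ (Fin n) → ℝ)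
    (hW : StronglyMeasurable W) (B : ℝ) (hB : ∀ x, ‖W x‖ ≤ B) :
    ∫ x, PP n a b ‖x‖ * W x = ∫ τ in a..b, (τ ^ (n-1))⁻¹ * ∫ x in ball 0 τ, W x := by
  simp only [PP_eq, ← integral_mul_const]
  rw [integral_integral_swap]
  · rw [intervalIntegral.integral_of_le hab.le, ← integral_indicator measurableSet_Ioc]
    congr 1; ext τ
    by_cases h1 : τ ∈ Ioc a b
    · rw [indicator_of_mem h1, ← integral_indicator measurableSet_ball, ← integral_const_mul]
      congr 1; ext x
      by_cases h2 : x ∈ ball (0 : EuclideanSpace ℝ (Fin n)) τ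
      · rw [indicator_of_mem h2, indicator_of_mem h2, kk, indicator_of_mem h1]
      · rw [indicator_of_notMem h2, indicator_of_notMem h2]; simp
    · rw [indicator_of_notMem h1, kk, indicator_of_notMem h1]
      simp
  · have h1 : Integrable ((ball (0 : EuclideanSpace ℝ (Fin n)) b).indicator fun _ => (1:ℝ)) := by
      rw [integrable_indicator_iff measurableSet_ball]
      exact integrableOn_const measure_ball_lt_top.ne
    have h2 := h1.mul_prod (kk_int n ha (b := b))
    refine (h2.mul_const B).mono ?_ ?_
    · apply Measurable.aestronglyMeasurable
      refine Measurable.mul ?_ (hW.measurable.comp measurable_fst)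
      have : (fun p : EuclideanSpace ℝ (Fin n) × ℝ => (ball (0 : EuclideanSpace ℝ (Fin n)) p.2).indicator (fun _ => kk n a b p.2) p.1) =
          ({p : EuclideanSpace ℝ (Fin n) × ℝ | ‖p.1‖ < p.2}).indicator fun p => kk n a b p.2 := by
        ext p; simp [indicator]
      rw [this]
      exact ((kk_meas n a b).comp measurable_snd).indicator (measurableSet_lt (by fun_prop) (by fun_prop))
    · refine Filter.Eventually.of_forall fun p => ?_
      have hB0 : 0 ≤ B := (norm_nonneg _).trans (hB 0)
      simp only [Function.uncurry]
      by_cases h3 : p.1 ∈ ball (0 : EuclideanSpace ℝ (Fin n)) p.2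
      · rw [indicator_of_mem h3]
        by_cases h4 : p.2 ∈ Ioc a b
        · have h5 : p.1 ∈ ball (0 : EuclideanSpace ℝ (Fin n)) b := ball_subset_ball h4.2 h3
          rw [indicator_of_mem h5, one_mul, norm_mul, norm_mul, Real.norm_of_nonneg hB0]
          gcongr
          exact hB _
        · rw [kk, indicator_of_notMem h4]; simp
      · rw [indicator_of_notMem h3, zero_mul, norm_zero]; positivity

open Filter Topology in
theorem ball_cont (n : ℕ) (W : EuclideanSpace ℝ (Fin n) → ℝ)
    (hW : StronglyMeasurable W) (B : ℝ) (hB : ∀ x, ‖W x‖ ≤ B) {s : ℝ} (hs : 0 < s) :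
    ContinuousAt (fun τ => ∫ x in ball (0 : EuclideanSpace ℝ (Fin n)) τ, W x) s := by
  simp only [← integral_indicator measurableSet_ball]
  have hB0 : 0 ≤ B := (norm_nonneg _).trans (hB 0)
  apply tendsto_integral_filter_of_dominated_convergence ((ball (0 : EuclideanSpace ℝ (Fin n)) (s+1)).indicator fun _ => B)
  · exact Eventually.of_forall fun τ => (hW.indicator measurableSet_ball).aestronglyMeasurable
  · filter_upwards [Iio_mem_nhds (lt_add_one s)] with τ hτ
    refine Eventually.of_forall fun x => ?_
    by_cases h : x ∈ ball (0 : EuclideanSpace ℝ (Fin n)) τ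
    · rw [indicator_of_mem h, indicator_of_mem (ball_subset_ball (le_of_lt hτ) h)]
      exact hB x
    · rw [indicator_of_notMem h, norm_zero]
      exact indicator_nonneg (fun _ _ => hB0) _
  · rw [integrable_indicator_iff measurableSet_ball]
    exact integrableOn_const measure_ball_lt_top.ne
  · have := Measure.addHaar_sphere_of_ne_zero (volume : Measure (EuclideanSpace ℝ (Fin n))) 0 hs.ne'
    filter_upwards [measure_eq_zero_iff_ae_notMem.1 this] with x hx
    have hx' : ‖x‖ ≠ s := by simpa using hx
    rcases lt_or_gt_of_ne hx' with h | h
    · apply tendsto_nhds_of_eventually_eq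
      filter_upwards [Ioi_mem_nhds h] with τ hτ
      have h1 : x ∈ ball (0 : EuclideanSpace ℝ (Fin n)) τ := by simpa using hτ
      have h2 : x ∈ ball (0 : EuclideanSpace ℝ (Fin n)) s := by simpa using h
      rw [indicator_of_mem h1, indicator_of_mem h2]
    · apply tendsto_nhds_of_eventually_eq
      filter_upwards [Iio_mem_nhds h] with τ hτ
      have h1 : x ∉ ball (0 : EuclideanSpace ℝ (Fin n)) τ := by simpa using (le_of_lt hτ)
      have h2 : x ∉ ball (0 : EuclideanSpace ℝ (Fin n)) s := by simpa using h.le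
      rw [indicator_of_notMem h1, indicator_of_notMem h2]

theorem riesz_const_step (n : ℕ) (α : ℝ) (h1 : 0 < α) (h2 : α + 2 < n) :
    rieszConst n (α + 2) * (α * (n - α - 2)) = rieszConst n α := by
  unfold rieszConst
  have e1 : (α + 2) / 2 = α / 2 + 1 := by ring
  have e2 : ((n : ℝ) - α) / 2 = ((n : ℝ) - (α + 2)) / 2 + 1 := by ring
  have hp : 0 < ((n : ℝ) - (α + 2)) / 2 := by linarith
  have e3 : (2 : ℝ) ^ (α + 2) = 2 ^ α * 4 := by
    rw [Real.rpow_add two_pos]; norm_num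
  rw [e1, e2, Real.Gamma_add_one (by positivity), Real.Gamma_add_one hp.ne', e3]
  have g1 : Real.Gamma (α / 2) ≠ 0 := (Real.Gamma_pos_of_pos (by positivity)).ne'
  have g2 : Real.Gamma (((n : ℝ) - (α + 2)) / 2) ≠ 0 := (Real.Gamma_pos_of_pos hp).ne'
  have p1 : Real.pi ^ ((n : ℝ) / 2) ≠ 0 := (Real.rpow_pos_of_pos Real.pi_pos _).ne'
  have p2 : (2 : ℝ) ^ α ≠ 0 := (Real.rpow_pos_of_pos two_pos _).ne'
  have hq : (n : ℝ) - (α + 2) ≠ 0 := by linarith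
  generalize Real.Gamma (α / 2) = A at *
  generalize Real.Gamma (((n : ℝ) - (α + 2)) / 2) = B at *
  generalize Real.pi ^ ((n : ℝ) / 2) = C at *
  generalize (2 : ℝ) ^ α = D at *
  field_simp
  ring

theorem fE_props (n : ℕ) (E : Set (EuclideanSpace ℝ (Fin n))) (hE : MeasurableSet E)
    (hvol : volume E = volume (ball (0 : EuclideanSpace ℝ (Fin n)) 1)) :
    Measurable (fE E) ∧ (∀ ξ, |fE E ξ| ≤ 1) ∧ Integrable (fE E) := by
  refine ⟨?_, ?_, ?_⟩
  · exact (measurable_one.indicator measurableSet_ball).sub (measurable_one.indicator hE)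
  · intro ξ
    unfold fE
    by_cases h1 : ξ ∈ ball (0 : EuclideanSpace ℝ (Fin n)) 1 <;> by_cases h2 : ξ ∈ E <;>
      simp only [indicator, h1, h2, if_true, if_false] <;> norm_num
  · apply Integrable.sub
    · exact (integrable_indicator_iff measurableSet_ball).2 (integrableOn_const measure_ball_lt_top.ne)
    · exact (integrable_indicator_iff hE).2 (integrableOn_const (hvol ▸ measure_ball_lt_top.ne))

theorem main_deriv (n : ℕ) (hn : 1 ≤ n) {γ : ℝ} (hγ : γ ≤ 0) (hγ2 : -(n : ℝ) < γ - 2)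
    (f : EuclideanSpace ℝ (Fin n) → ℝ) (hf : Integrable f) (hfm : Measurable f)
    (hf1 : ∀ ξ, |f ξ| ≤ 1) {s : ℝ} (hs : 0 < s) :
    HasDerivAt (fun r : ℝ => ∫ ω : sphere (0 : EuclideanSpace ℝ (Fin n)) 1,
        (∫ ξ, f ξ * ‖r • (ω : EuclideanSpace ℝ (Fin n)) - ξ‖ ^ γ)
        ∂(volume : Measure (EuclideanSpace ℝ (Fin n))).toSphere)
      ((s ^ (n - 1))⁻¹ * ∫ x in ball (0 : EuclideanSpace ℝ (Fin n)) s,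
        ∫ ξ, f ξ * (γ * (n + γ - 2) * ‖x - ξ‖ ^ (γ - 2))) s := by
  set W : EuclideanSpace ℝ (Fin n) → ℝ := fun x => ∫ ξ, f ξ * (γ * (n + γ - 2) * ‖x - ξ‖ ^ (γ - 2)) with hWd
  have hW : StronglyMeasurable W :=
    pot_meas n f (fun y => γ * (n + γ - 2) * ‖y‖ ^ (γ - 2)) hfm (by fun_prop)
  obtain ⟨B, hB⟩ : ∃ B, ∀ x, ‖W x‖ ≤ B :=
    ⟨_, fun x => pot_bound n hn hγ2 (by linarith) f hf hf1 (|γ * (n + γ - 2)|) (abs_nonneg _)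
      (fun y => γ * (n + γ - 2) * ‖y‖ ^ (γ - 2)) (fun y _ => by
        rw [norm_mul, Real.norm_eq_abs, Real.norm_of_nonneg (by positivity)]) x⟩
  set U : EuclideanSpace ℝ (Fin n) → ℝ := fun x => ∫ ξ, f ξ * ‖x - ξ‖ ^ γ with hUd
  have hU : StronglyMeasurable U := pot_meas n f (fun y => ‖y‖ ^ γ) hfm (by fun_prop)
  obtain ⟨B', hB'⟩ : ∃ B, ∀ x, ‖U x‖ ≤ B :=
    ⟨_, fun x => pot_bound n hn (by linarith) hγ f hf hf1 1 zero_le_one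
      (fun y => ‖y‖ ^ γ) (fun y _ => by
        rw [one_mul, Real.norm_of_nonneg (by positivity)]) x⟩
  have hint : ∀ r : ℝ, Integrable (fun ω : sphere (0 : EuclideanSpace ℝ (Fin n)) 1 =>
      U (r • (ω : EuclideanSpace ℝ (Fin n)))) (volume : Measure (EuclideanSpace ℝ (Fin n))).toSphere := by
    intro r
    refine Integrable.of_bound (hU.comp_measurable (by fun_prop)).aestronglyMeasurable B' ?_
    exact Filter.Eventually.of_forall fun ω => hB' _
  have hc : ∀ τ : ℝ, 0 < τ → ContinuousAt (fun τ : ℝ => (τ ^ (n - 1))⁻¹ * ∫ x in ball (0 : EuclideanSpace ℝ (Fin n)) τ, W x) τ := by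
    intro τ hτ
    refine ContinuousAt.mul ?_ (ball_cont n W hW B hB hτ)
    exact (continuousAt_id.pow _).inv₀ (pow_pos hτ _).ne'
  have hcO : ContinuousOn (fun τ : ℝ => (τ ^ (n - 1))⁻¹ * ∫ x in ball (0 : EuclideanSpace ℝ (Fin n)) τ, W x) (Ioi 0) :=
    fun τ hτ => (hc τ hτ).continuousWithinAt
  have hF : HasDerivAt (fun b : ℝ => ∫ τ in (s/2)..b, (τ ^ (n - 1))⁻¹ * ∫ x in ball (0 : EuclideanSpace ℝ (Fin n)) τ, W x)
      ((s ^ (n - 1))⁻¹ * ∫ x in ball (0 : EuclideanSpace ℝ (Fin n)) s, W x) s := by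
    refine intervalIntegral.integral_hasDerivAt_right ?_ ?_ (hc s hs)
    · refine (hcO.mono ?_).intervalIntegrable
      rw [uIcc_of_le (by linarith)]
      intro x hx
      exact lt_of_lt_of_le (by linarith) hx.1
    · exact hcO.stronglyMeasurableAtFilter isOpen_Ioi s hs
  refine (hF.const_add (∫ ω : sphere (0 : EuclideanSpace ℝ (Fin n)) 1, U ((s/2) • (ω : EuclideanSpace ℝ (Fin n)))
        ∂(volume : Measure (EuclideanSpace ℝ (Fin n))).toSphere)).congr_of_eventuallyEq ?_
  filter_upwards [lt_mem_nhds (show s / 2 < s by linarith)] with b hb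
  have h := pot_ident n hn hγ hγ2 (half_pos hs) hb f hf hfm hf1
  rw [PP_fubini n (half_pos hs) hb W hW B hB] at h
  rw [h]
  have h2 := integral_sub (hint b) (hint (s/2))
  simp only [hUd] at h2 ⊢
  rw [h2]; ring

/-- Derivative formula for the spherical averages: `φ_{α+2}'(s) = -(s/n) Φ_α(s)`. -/
theorem statement17 (n : ℕ) (hn : 5 ≤ n) (α : ℝ) (hα : α ∈ Set.Icc 2 ((n : ℝ) - 3))
    (E : Set (EuclideanSpace ℝ (Fin n))) (hE : HasFinitePerimeter E)
    (hvol : volume E = volume (ball (0 : EuclideanSpace ℝ (Fin n)) 1))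
    (hmono : AntitoneOn (sphAvg (rieszPot α (fE E))) (Set.Ioi 0)) :
    ∀ s : ℝ, 0 < s →
      HasDerivAt (sphAvg (rieszPot (α + 2) (fE E)))
        (-(s / (n : ℝ)) * ballAvg (rieszPot α (fE E)) s) s := by
  intro s hs
  obtain ⟨hα1, hα2⟩ := hα
  obtain ⟨hfm, hf1, hf⟩ := fE_props n E hE.1 hvol
  have hn1 : 1 ≤ n := by omega
  have hnpos : (0 : ℝ) < n := by exact_mod_cast (show 0 < n by omega)
  have hd := main_deriv n hn1 (γ := α + 2 - n) (by linarith) (by linarith) (fE E) hf hfm hf1 hs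
  have hd2 := hd.const_mul (((n : ℝ) * (volume : Measure (EuclideanSpace ℝ (Fin n))).real (ball 0 1))⁻¹ * rieszConst n (α + 2))
  have hM : StronglyMeasurable (rieszPot (α + 2) (fE E)) :=
    (pot_meas n (fE E) (fun y => ‖y‖ ^ (α + 2 - (n : ℝ))) hfm (by fun_prop)).const_mul _
  have hev : sphAvg (rieszPot (α + 2) (fE E)) =ᶠ[nhds s] fun r =>
      (((n : ℝ) * (volume : Measure (EuclideanSpace ℝ (Fin n))).real (ball 0 1))⁻¹ * rieszConst n (α + 2)) *
      ∫ ω : sphere (0 : EuclideanSpace ℝ (Fin n)) 1,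
        (∫ ξ, fE E ξ * ‖r • (ω : EuclideanSpace ℝ (Fin n)) - ξ‖ ^ (α + 2 - (n : ℝ)))
        ∂(volume : Measure (EuclideanSpace ℝ (Fin n))).toSphere := by
    filter_upwards [lt_mem_nhds hs] with r hr
    rw [aux_sphAvg n hn1 r hr _ hM]
    unfold rieszPot
    rw [integral_const_mul, mul_assoc]
  refine (hd2.congr_of_eventuallyEq hev).congr_deriv ?_
  have e1 : (n : ℝ) + (α + 2 - n) - 2 = α := by ring
  have e2 : α + 2 - (n : ℝ) - 2 = α - n := by ring
  have e3 : ∀ x : EuclideanSpace ℝ (Fin n), ∫ ξ, fE E ξ * ((α + 2 - (n : ℝ)) * α * ‖x - ξ‖ ^ (α - (n : ℝ))) =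
      ((α + 2 - (n : ℝ)) * α) * ∫ ξ, fE E ξ * ‖x - ξ‖ ^ (α - (n : ℝ)) := by
    intro x
    rw [← integral_const_mul]
    congr 1; ext ξ; ring
  have hv : (volume (ball (0 : EuclideanSpace ℝ (Fin n)) s)).toReal =
      s ^ n * (volume : Measure (EuclideanSpace ℝ (Fin n))).real (ball 0 1) := by
    rw [Measure.addHaar_ball_of_pos _ _ hs, ENNReal.toReal_mul, ENNReal.toReal_ofReal (by positivity)]
    simp [Measure.real]
  have hvp : 0 < (volume : Measure (EuclideanSpace ℝ (Fin n))).real (ball 0 1) := by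
    rw [Measure.real]
    exact ENNReal.toReal_pos (measure_ball_pos _ _ one_pos).ne' measure_ball_lt_top.ne
  simp only [e1, e2, e3]
  unfold ballAvg rieszPot
  rw [integral_const_mul, integral_const_mul, hv, ← riesz_const_step n α (by linarith) (by linarith)]
  obtain ⟨k, rfl⟩ : ∃ k, n = k + 1 := ⟨n - 1, by omega⟩
  rw [Nat.add_sub_cancel, pow_succ]
  generalize (∫ x in ball (0 : EuclideanSpace ℝ (Fin (k+1))) s, ∫ ξ, fE E ξ * ‖x - ξ‖ ^ (α - ((k + 1 : ℕ) : ℝ))) = J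
  generalize (volume : Measure (EuclideanSpace ℝ (Fin (k+1)))).real (ball 0 1) = v at *
  generalize rieszConst (k+1) (α+2) = c
  have hs' := hs.ne'
  field_simp
  ring
end
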